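/- arXiv:2204.04057 — 4 statements merged into one kernel-verified Lean document; each statement's English description precedes it below -/
import Mathlib

section
/- There exist constants c, C > 0 such that, for all sufficiently large n, the Packing process on n bins satisfies 1 + c ≤ E[η^m] ≤ C for every round m ≥ 2, where η^m := W^m/S^m is the sample efficiency and S^m = m is the number of bins sampled by round m (so η^m = W^m/m for Packing). -/
open MeasureTheory ProbabilityTheory Real Finset
open scoped ENNReal Classical

noncomputable section

/-- An allocation process on `n` bins: a probability space with a filtration,
load vectors `x t`, and a sampled bin `sel t` in each round. -/
structure AllocProc (n : ℕ) where
  Ω : Type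
  m0 : MeasurableSpace Ω
  μ : Measure Ω
  prob : IsProbabilityMeasure μ
  F : Filtration ℕ m0
  x : ℕ → Ω → Fin n → ℕ
  sel : ℕ → Ω → Fin n
  x_zero : ∀ ω i, x 0 ω i = 0
  meas_x : ∀ t i, Measurable[F t] fun ω => x t ω i
  meas_sel : ∀ t, Measurable[F (t + 1)] (sel t)

namespace AllocProc

variable {n : ℕ} (P : AllocProc n)

/-- Total number of balls allocated after `t` rounds. -/
def W (t : ℕ) (ω : P.Ω) : ℕ := ∑ i, P.x t ω i

/-- Normalized load of bin `i` after `t` rounds. -/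
def y (t : ℕ) (ω : P.Ω) (i : Fin n) : ℝ := (P.x t ω i : ℝ) - (P.W t ω : ℝ) / n

/-- The gap between maximum and average load after `t` rounds. -/
def Gap (t : ℕ) (ω : P.Ω) : ℝ := (⨆ i, (P.x t ω i : ℝ)) - (P.W t ω : ℝ) / n

/-- The absolute value potential `Δ^t`. -/
def Δpot (t : ℕ) (ω : P.Ω) : ℝ := ∑ i, |P.y t ω i|

/-- Condition `𝒫`: in each round the sampled bin is chosen according to a probability
vector (conditional on the past) which, indexed by decreasing load, is majorized by the
uniform distribution. -/
def CondP : Prop :=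
  ∃ σ : ℕ → P.Ω → Equiv.Perm (Fin n),
    (∀ t ω, Antitone fun k => P.y t ω (σ t ω k)) ∧
    (∀ (t k : ℕ),
      ∀ᵐ ω ∂P.μ,
        (P.μ[({ω' | ((σ t ω').symm (P.sel t ω') : ℕ) < k} : Set P.Ω).indicator
            (fun _ => (1 : ℝ)) | P.F t]) ω ≤ (k : ℝ) / n)

/-- Condition `𝒲`: if the sampled bin is overloaded it gets one ball; otherwise exactly
`⌈-y⌉ + 1` balls are placed into underloaded bins, with at most one bin receiving
`⌈-y⌉ + 1` balls, at most one receiving `⌈-y⌉` balls, and all others at most `⌈-y⌉ - 1`. -/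
def CondW : Prop :=
  ∀ t ω,
    (0 ≤ P.y t ω (P.sel t ω) →
      ∀ j, P.x (t + 1) ω j = P.x t ω j + if j = P.sel t ω then 1 else 0) ∧
    (P.y t ω (P.sel t ω) < 0 →
      (∀ j, P.x t ω j ≤ P.x (t + 1) ω j) ∧
      (∀ j, 0 ≤ P.y t ω j → P.x (t + 1) ω j = P.x t ω j) ∧
      (P.W (t + 1) ω = P.W t ω + ⌈-(P.y t ω (P.sel t ω))⌉₊ + 1) ∧
      (∃ k1 k2 : Fin n, P.y t ω k1 < 0 ∧ P.y t ω k2 < 0 ∧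
        ((P.x (t + 1) ω k1 : ℤ) ≤ (P.x t ω k1 : ℤ) + ⌈-(P.y t ω k1)⌉ + 1) ∧
        ((P.x (t + 1) ω k2 : ℤ) ≤ (P.x t ω k2 : ℤ) + ⌈-(P.y t ω k2)⌉) ∧
        (∀ j, P.y t ω j < 0 → j ≠ k1 → j ≠ k2 →
          (P.x (t + 1) ω j : ℤ) ≤ (P.x t ω j : ℤ) + ⌈-(P.y t ω j)⌉ - 1)))

/-- The bin sampled in each round is uniform, conditionally on the past. -/
def UniformSampling : Prop :=
  ∀ (t : ℕ) (i : Fin n),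
    ∀ᵐ ω ∂P.μ,
      (P.μ[({ω' | P.sel t ω' = i} : Set P.Ω).indicator (fun _ => (1 : ℝ)) | P.F t]) ω
        = 1 / n

/-- The allocation rule of the `Packing` process: one ball into the sampled bin if it is
overloaded; otherwise the sampled bin is filled up to load `⌈W^t/n⌉ + 1`. -/
def PackingRule : Prop :=
  ∀ t ω j,
    P.x (t + 1) ω j =
      if j = P.sel t ω then
        if (P.W t ω : ℝ) / n ≤ (P.x t ω j : ℝ) then P.x t ω j + 1
        else ⌈(P.W t ω : ℝ) / n⌉₊ + 1
      else P.x t ω j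

/-- The `Packing` process: uniform sampling together with the packing allocation rule. -/
def IsPacking : Prop := P.UniformSampling ∧ P.PackingRule

/-- The exponential potential `Φ^t(α)`, over bins overloaded by at least two balls. -/
def Φ (α : ℝ) (t : ℕ) (ω : P.Ω) : ℝ :=
  ∑ i, if 2 ≤ P.y t ω i then Real.exp (α * P.y t ω i) else 0

end AllocProc

namespace AllocProc

variable {n : ℕ} (P : AllocProc n)

/-- The "good event" `𝒢^t`: at least `n/20` underloaded bins, or `Δ^t ≥ n/10`. -/
def Gev (t : ℕ) : Set P.Ω :=
  {ω | (n : ℝ) / 20 ≤ ((Finset.univ.filter fun i => P.y t ω i < 0).card : ℝ) ∨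
       (n : ℝ) / 10 ≤ P.Δpot t ω}

/-- `G_{t0}^s`: number of rounds `r ∈ [t0, s)` in which the good event `𝒢^r` holds. -/
def GCount (t0 s : ℕ) (ω : P.Ω) : ℕ :=
  ((Finset.Ico t0 s).filter fun r => ω ∈ P.Gev r).card

/-- The adjusted potential `Φ̃^s` (relative to a starting round `t0`). -/
def tildePhi (α c1 c2 c3 : ℝ) (t0 s : ℕ) (ω : P.Ω) : ℝ :=
  P.Φ α s ω * Real.exp (c2 * α / n * (P.GCount t0 (s - 1) ω : ℝ)) *
      Real.exp (-(c1 * α ^ 2 / n) * (((s - 1 - t0) - P.GCount t0 (s - 1) ω : ℕ) : ℝ)) -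
    c3 * ((s - t0 : ℕ) : ℝ)

/-- An `(a,b)`-biased sampling vector: conditionally on the past, each bin is sampled with
probability between `1/(a n)` and `b/n`. -/
def BiasedSampling (a b : ℝ) : Prop :=
  ∀ (t : ℕ) (i : Fin n),
    ∀ᵐ ω ∂P.μ,
      1 / (a * n) ≤
          (P.μ[({ω' | P.sel t ω' = i} : Set P.Ω).indicator (fun _ => (1 : ℝ)) | P.F t]) ω ∧
        (P.μ[({ω' | P.sel t ω' = i} : Set P.Ω).indicator (fun _ => (1 : ℝ)) | P.F t]) ω ≤ b / n

/-- The exponential potential over all non-underloaded bins. -/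
def Ψ (α : ℝ) (t : ℕ) (ω : P.Ω) : ℝ :=
  ∑ i, if 0 ≤ P.y t ω i then Real.exp (α * P.y t ω i) else 0

/-- An unfolding of the process `P`: one ball is allocated per atomic allocation, balls are
never removed, and after `W^t` atomic allocations the load vector agrees with `x^t`. -/
def IsUnfolding (u : ℕ → P.Ω → Fin n → ℕ) : Prop :=
  (∀ ω i, u 0 ω i = 0) ∧
  (∀ s ω, (∀ i, u s ω i ≤ u (s + 1) ω i) ∧ (∑ i, u (s + 1) ω i) = (∑ i, u s ω i) + 1) ∧
  (∀ t ω, u (P.W t ω) ω = P.x t ω)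

/-- The gap of an unfolding after `s` atomic allocations. -/
def GapU (u : ℕ → P.Ω → Fin n → ℕ) (s : ℕ) (ω : P.Ω) : ℝ :=
  (⨆ i, (u s ω i : ℝ)) - (s : ℝ) / n

end AllocProc

namespace PackingDrift

variable {n : ℕ}

/-- The average load of a load vector. -/
def avg (x : Fin n → ℕ) : ℝ := ((∑ i, x i : ℕ) : ℝ) / n

/-- The number of balls missing in an underloaded bin to reach the rounded-up average. -/
def deficit (x : Fin n → ℕ) (i : Fin n) : ℕ :=
  if avg x ≤ x i then 0 else ⌈avg x⌉₊ - x i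

/-- The load vector after the `Packing` process samples bin `i`. -/
def step (x : Fin n → ℕ) (i : Fin n) : Fin n → ℕ :=
  Function.update x i (x i + (deficit x i + 1))

/-- The quadratic potential `∑ y_i²`. -/
def quad (x : Fin n → ℕ) : ℝ := ∑ i, ((x i : ℝ) - avg x) ^ 2

/-- Total loads just below, or equal to, a multiple of the number of bins. -/
def NearMultiple (n w : ℕ) : Prop := w % n = 0 ∨ 3 * n < 4 * (w % n)

lemma sum_step (x : Fin n → ℕ) (i : Fin n) :
    ∑ j, step x i j = ∑ j, x j + (deficit x i + 1) := by
  unfold step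
  rw [Finset.sum_update_of_mem (Finset.mem_univ i),
    ← Finset.add_sum_erase _ x (Finset.mem_univ i), Finset.sdiff_singleton_eq_erase]
  ring

lemma sum_sq_step (x : Fin n → ℕ) (i : Fin n) :
    ∑ j, (step x i j : ℝ) ^ 2 =
      ∑ j, (x j : ℝ) ^ 2 + ((deficit x i : ℝ) + 1) * (2 * x i + (deficit x i + 1)) := by
  rw [← Finset.add_sum_erase _ _ (Finset.mem_univ i),
    ← Finset.add_sum_erase _ (fun j => (x j : ℝ) ^ 2) (Finset.mem_univ i)]
  have h : ∑ j ∈ Finset.univ.erase i, (step x i j : ℝ) ^ 2 =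
      ∑ j ∈ Finset.univ.erase i, (x j : ℝ) ^ 2 :=
    Finset.sum_congr rfl fun j hj => by simp [step, Finset.ne_of_mem_erase hj]
  rw [h]
  simp only [step, Function.update_self]
  push_cast
  ring

lemma sum_sub_avg (hn : 0 < n) (x : Fin n → ℕ) : ∑ i, ((x i : ℝ) - avg x) = 0 := by
  have : (n : ℝ) ≠ 0 := by positivity
  simp only [avg, Finset.sum_sub_distrib, Finset.sum_const, Finset.card_univ, Fintype.card_fin,
    nsmul_eq_mul]
  push_cast
  field_simp
  ring

lemma quad_eq (hn : 0 < n) (x : Fin n → ℕ) :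
    quad x = ∑ i, (x i : ℝ) ^ 2 - ((∑ i, x i : ℕ) : ℝ) ^ 2 / n := by
  have hn' : (n : ℝ) ≠ 0 := by positivity
  have h : ∀ i, ((x i : ℝ) - avg x) ^ 2 =
      (x i : ℝ) ^ 2 - 2 * avg x * ((x i : ℝ) - avg x) - avg x ^ 2 := fun i => by ring
  unfold quad
  simp only [h, Finset.sum_sub_distrib, ← Finset.mul_sum]
  rw [← Finset.sum_sub_distrib, sum_sub_avg hn]
  simp only [Finset.sum_const, Finset.card_univ, Fintype.card_fin, nsmul_eq_mul, avg]
  field_simp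
  ring

lemma quad_nonneg (x : Fin n → ℕ) : 0 ≤ quad x := Finset.sum_nonneg fun _ _ => sq_nonneg _

lemma quad_step_le (hn : 0 < n) (x : Fin n → ℕ) (i : Fin n) :
    quad (step x i) ≤
      quad x + ((deficit x i : ℝ) + 1) * (2 * ((x i : ℝ) - avg x) + (deficit x i + 1)) := by
  have hn' : (0 : ℝ) < n := by positivity
  rw [quad_eq hn, quad_eq hn, sum_sq_step, sum_step]
  have h : 0 ≤ ((deficit x i : ℝ) + 1) ^ 2 / n := by positivity
  have h2 : (((∑ j, x j : ℕ) + (deficit x i + 1) : ℕ) : ℝ) ^ 2 / n =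
      ((∑ j, x j : ℕ) : ℝ) ^ 2 / n + 2 * ((deficit x i : ℝ) + 1) * avg x +
        ((deficit x i : ℝ) + 1) ^ 2 / n := by
    unfold avg
    push_cast
    field_simp
    ring
  rw [h2]
  nlinarith

lemma avg_nonneg (x : Fin n → ℕ) : 0 ≤ avg x := by unfold avg; positivity

lemma deficit_eq_zero {x : Fin n → ℕ} {i : Fin n} (h : avg x ≤ x i) : deficit x i = 0 :=
  if_pos h

lemma cast_deficit {x : Fin n → ℕ} {i : Fin n} (h : ¬ avg x ≤ x i) :
    (deficit x i : ℝ) = (⌈avg x⌉₊ : ℝ) - x i := by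
  rw [deficit, if_neg h, Nat.cast_sub]
  exact (Nat.lt_ceil.2 (not_le.1 h)).le

lemma one_le_deficit {x : Fin n → ℕ} {i : Fin n} (h : ¬ avg x ≤ x i) :
    1 ≤ deficit x i := by
  rw [deficit, if_neg h]
  have := Nat.lt_ceil.2 (not_le.1 h)
  omega

lemma neg_le_deficit (x : Fin n → ℕ) (i : Fin n) : avg x - x i ≤ deficit x i := by
  by_cases h : avg x ≤ x i
  · rw [deficit_eq_zero h]; push_cast; linarith
  · rw [cast_deficit h]; linarith [Nat.le_ceil (avg x)]

lemma quadratic_increment_le (x : Fin n → ℕ) (i : Fin n) :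
    ((deficit x i : ℝ) + 1) * (2 * ((x i : ℝ) - avg x) + (deficit x i + 1)) ≤
      8 - deficit x i + 2 * ((x i : ℝ) - avg x) := by
  by_cases h : avg x ≤ x i
  · rw [deficit_eq_zero h]; push_cast; linarith
  · have h1 := neg_le_deficit x i
    have h2 : (deficit x i : ℝ) < avg x - x i + 1 := by
      rw [cast_deficit h]; linarith [Nat.ceil_lt_add_one (avg_nonneg x)]
    push Not at h
    nlinarith [sq_nonneg (2 * (avg x - x i) - 3)]

lemma le_deficit_of_not_nearMultiple (hn : 0 < n) (x : Fin n → ℕ)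
    (hx : ¬ NearMultiple n (∑ i, x i)) (i : Fin n) :
    1 / 5 - 4 / 5 * ((x i : ℝ) - avg x) ≤ deficit x i := by
  have hn' : (0 : ℝ) < n := by positivity
  by_cases h : avg x ≤ x i
  · rw [deficit_eq_zero h]
    simp only [NearMultiple, not_or, not_lt] at hx
    set w := ∑ i, x i with hw
    have hdiv := Nat.div_add_mod w n
    have hq : w / n < x i := by
      by_contra! hle
      have h1 : (w : ℝ) ≤ x i * n := by
        have := h; unfold avg at this; rwa [div_le_iff₀ hn'] at this
      have h2 : w ≤ x i * n := by exact_mod_cast h1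
      have h3 := Nat.mul_le_mul_right n hle
      have h4 := Nat.pos_of_ne_zero hx.1
      nlinarith
    have h1 : avg x ≤ x i - 1 / 4 := by
      unfold avg
      rw [div_le_iff₀ hn', ← hw]
      have h2 : ((w / n : ℕ) : ℝ) + 1 ≤ x i := by exact_mod_cast hq
      have h3 : 4 * ((w % n : ℕ) : ℝ) ≤ 3 * n := by exact_mod_cast hx.2
      have h4 : (n : ℝ) * (w / n : ℕ) + (w % n : ℕ) = w := by exact_mod_cast hdiv
      nlinarith
    push_cast
    linarith
  · have h1 : (1 : ℝ) ≤ deficit x i := by exact_mod_cast one_le_deficit h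
    linarith [neg_le_deficit x i]

/-- The number of total loads below `w` that are near a multiple of `n`. -/
def nearCount (n w : ℕ) : ℕ := Nat.count (NearMultiple n) w

lemma nearCount_succ (n w : ℕ) :
    nearCount n (w + 1) = nearCount n w + if NearMultiple n w then 1 else 0 :=
  Nat.count_succ _ _

lemma nearCount_mul_add_le (hn : 12 ≤ n) (q r : ℕ) (hr : r + 1 ≤ n)
    (h0 : 3 * (nearCount n (n * q) : ℤ) ≤ n * q) :
    3 * (nearCount n (n * q + (r + 1)) : ℤ) ≤
      n * q + (r + 1) + max (2 - r : ℤ) (2 * (r + 1 - n)) := by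
  induction r with
  | zero =>
    rw [zero_add, nearCount_succ]
    push_cast
    split_ifs <;> omega
  | succ r ih =>
    have ih := ih (by omega)
    rw [← add_assoc, nearCount_succ]
    have hmod : (n * q + (r + 1)) % n = r + 1 := by
      rw [Nat.mul_add_mod, Nat.mod_eq_of_lt (by omega)]
    have : NearMultiple n (n * q + (r + 1)) ↔ 3 * n < 4 * (r + 1) := by
      simp [NearMultiple, hmod]
    rw [if_congr this rfl rfl]
    push_cast at ih ⊢
    clear hmod this
    generalize (n : ℤ) * q = z at *
    split_ifs <;> omega

lemma nearCount_mul_le (hn : 12 ≤ n) (q : ℕ) : 3 * (nearCount n (n * q) : ℤ) ≤ n * q := by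
  induction q with
  | zero => simp [nearCount]
  | succ q ih =>
    have h := nearCount_mul_add_le hn q (n - 1) (by omega) ih
    rw [Nat.sub_add_cancel (by omega)] at h
    push_cast [mul_add, Nat.cast_sub (show 1 ≤ n by omega)] at h ⊢
    rw [mul_one] at *
    generalize (n : ℤ) * q = z at *
    omega

lemma nearCount_le (hn : 12 ≤ n) (w : ℕ) : 3 * nearCount n w ≤ w + 2 := by
  have hdiv := Nat.div_add_mod w n
  have hlt := Nat.mod_lt w (show 0 < n by omega)
  have h0 := nearCount_mul_le hn (w / n)
  obtain hr | ⟨r, hr⟩ : w % n = 0 ∨ ∃ r, w % n = r + 1 := by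
    cases w % n <;> simp
  · rw [hr, add_zero] at hdiv
    rw [hdiv] at h0
    have h1 : (n : ℤ) * (w / n : ℕ) = w := by exact_mod_cast hdiv
    omega
  · have h := nearCount_mul_add_le hn (w / n) r (by omega) h0
    rw [← hr, hdiv] at h
    have h1 : (n : ℤ) * (w / n : ℕ) + (w % n : ℕ) = w := by exact_mod_cast hdiv
    generalize (n : ℤ) * (w / n : ℕ) = z at *
    omega

/-- The potential controlling the total load from above. -/
def upperPot (x : Fin n → ℕ) : ℝ := ((∑ i, x i : ℕ) : ℝ) + quad x

/-- The potential controlling the total load from below. -/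
def lowerPot (x : Fin n → ℕ) : ℝ :=
  ((∑ i, x i : ℕ) : ℝ) + (nearCount n (∑ i, x i) : ℝ) / 5

lemma sum_upperPot_step_le (hn : 0 < n) (x : Fin n → ℕ) :
    ∑ i, upperPot (step x i) ≤ n * (upperPot x + 9) := by
  calc ∑ i, upperPot (step x i)
      ≤ ∑ i, ((upperPot x + 9) + 2 * ((x i : ℝ) - avg x)) := by
        refine Finset.sum_le_sum fun i _ => ?_
        have h1 := quad_step_le hn x i
        have h2 := quadratic_increment_le x i
        unfold upperPot
        rw [sum_step]
        push_cast
        linarith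
    _ = n * (upperPot x + 9) := by
        rw [Finset.sum_add_distrib, ← Finset.mul_sum, sum_sub_avg hn]
        simp [mul_add]

lemma le_sum_lowerPot_step (hn : 0 < n) (x : Fin n → ℕ) :
    n * (lowerPot x + 6 / 5) ≤ ∑ i, lowerPot (step x i) := by
  calc n * (lowerPot x + 6 / 5)
      = ∑ i, ((lowerPot x + 6 / 5) - 4 / 5 * ((x i : ℝ) - avg x)) := by
        rw [Finset.sum_sub_distrib, ← Finset.mul_sum, sum_sub_avg hn]
        simp [mul_add]
    _ ≤ ∑ i, lowerPot (step x i) := by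
        refine Finset.sum_le_sum fun i _ => ?_
        unfold lowerPot
        rw [sum_step]
        set w := ∑ i, x i with hw
        have hmono : nearCount n (w + 1) ≤ nearCount n (w + (deficit x i + 1)) :=
          Nat.count_monotone _ (by omega)
        rw [nearCount_succ] at hmono
        have hmono' : (nearCount n w : ℝ) + ((if NearMultiple n w then 1 else 0 : ℕ) : ℝ) ≤
            nearCount n (w + (deficit x i + 1)) := by exact_mod_cast hmono
        have h0 : (0 : ℝ) ≤ deficit x i := Nat.cast_nonneg _
        have h1 := neg_le_deficit x i
        have h2 := le_deficit_of_not_nearMultiple hn x (i := i)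
        push_cast at hmono' ⊢
        split_ifs at hmono' with hb
        · linarith
        · linarith [h2 hb]

lemma x_succ {P : AllocProc n} (hP : P.PackingRule) (t : ℕ) (ω : P.Ω) :
    P.x (t + 1) ω = step (P.x t ω) (P.sel t ω) := by
  funext j
  rw [hP t ω j]
  by_cases hj : j = P.sel t ω
  · subst hj
    have key : (P.W t ω : ℝ) / n = avg (P.x t ω) := rfl
    rw [if_pos rfl, key]
    simp only [step, Function.update_self, deficit]
    split_ifs with h
    · rfl
    · have := Nat.lt_ceil.2 (not_le.1 h)
      omega
  · simp [step, hj]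

lemma exists_load_bound (hn : 0 < n) {P : AllocProc n} (hP : P.PackingRule) (t : ℕ) :
    ∃ B : ℕ, ∀ ω i, P.x t ω i ≤ B := by
  induction t with
  | zero => exact ⟨0, fun ω i => (P.x_zero ω i).le⟩
  | succ t ih =>
    obtain ⟨B, hB⟩ := ih
    refine ⟨B + 1, fun ω i => ?_⟩
    have hn' : (0 : ℝ) < n := by positivity
    have havg : (P.W t ω : ℝ) / n ≤ B := by
      rw [div_le_iff₀ hn']
      have : P.W t ω ≤ n * B := by
        simpa [AllocProc.W] using Finset.sum_le_card_nsmul Finset.univ _ B fun i _ => hB ω i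
      rw [mul_comm]
      exact_mod_cast this
    have hceil := Nat.ceil_le.2 havg
    have := hB ω i
    rw [hP t ω i]
    split_ifs <;> omega

lemma stronglyMeasurable_comp (P : AllocProc n) (t : ℕ) (f : (Fin n → ℕ) → ℝ) :
    StronglyMeasurable[P.F t] fun ω => f (P.x t ω) := by
  let _ := P.F t
  have : Measurable fun ω => P.x t ω := measurable_pi_lambda _ fun i => P.meas_x t i
  exact ((Measurable.of_discrete (f := f)).comp this).stronglyMeasurable

lemma integrable_comp (hn : 0 < n) {P : AllocProc n} (hP : P.PackingRule) (t : ℕ)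
    (f : (Fin n → ℕ) → ℝ) :
    letI := P.m0
    Integrable (fun ω => f (P.x t ω)) P.μ := by
  let _ := P.m0
  have := P.prob
  obtain ⟨B, hB⟩ := exists_load_bound hn hP t
  obtain ⟨C, hC⟩ := ((Set.finite_Iic (fun _ : Fin n => B)).image fun x => ‖f x‖).bddAbove
  refine Integrable.of_bound
    ((stronglyMeasurable_comp P t f).mono (P.F.le t)).aestronglyMeasurable C ?_
  exact ae_of_all _ fun ω => hC ⟨_, fun i => hB ω i, rfl⟩

lemma integral_indicator_sel (hn : 0 < n) {P : AllocProc n} (hP : P.IsPacking) (t : ℕ)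
    (f : (Fin n → ℕ) → ℝ) (i : Fin n) :
    letI := P.m0
    Integrable (fun ω => f (P.x t ω) *
        ({ω' | P.sel t ω' = i} : Set P.Ω).indicator (fun _ => (1 : ℝ)) ω) P.μ ∧
      ∫ ω, f (P.x t ω) * ({ω' | P.sel t ω' = i} : Set P.Ω).indicator (fun _ => (1 : ℝ)) ω ∂P.μ =
        1 / n * ∫ ω, f (P.x t ω) ∂P.μ := by
  let _ := P.m0
  have := P.prob
  have hs : MeasurableSet ({ω' | P.sel t ω' = i} : Set P.Ω) :=
    (P.F.le (t + 1)) _ (P.meas_sel t (measurableSet_singleton i))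
  have hf := integrable_comp hn hP.2 t f
  have hind : Integrable (({ω' | P.sel t ω' = i} : Set P.Ω).indicator fun _ => (1 : ℝ)) P.μ :=
    (integrable_const 1).indicator hs
  have hmul : Integrable ((fun ω => f (P.x t ω)) *
      ({ω' | P.sel t ω' = i} : Set P.Ω).indicator fun _ => (1 : ℝ)) P.μ := by
    refine hf.mul_bdd (c := 1) hind.aestronglyMeasurable (ae_of_all _ fun ω => ?_)
    rw [Set.indicator_apply]
    split_ifs <;> simp
  refine ⟨hmul, ?_⟩
  have hpull := condExp_mul_of_stronglyMeasurable_left (stronglyMeasurable_comp P t f) hmul hind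
  have := integral_condExp (μ := P.μ) (P.F.le t) (f := (fun ω => f (P.x t ω)) *
      ({ω' | P.sel t ω' = i} : Set P.Ω).indicator fun _ => (1 : ℝ))
  refine this.symm.trans ?_
  rw [← integral_const_mul]
  refine integral_congr_ae ?_
  filter_upwards [hpull, hP.1 t i] with ω h1 h2
  rw [h1, Pi.mul_apply, h2, mul_comm]

lemma integral_succ (hn : 0 < n) {P : AllocProc n} (hP : P.IsPacking) (t : ℕ)
    (V : (Fin n → ℕ) → ℝ) :
    letI := P.m0
    ∫ ω, V (P.x (t + 1) ω) ∂P.μ = 1 / n * ∫ ω, ∑ i, V (step (P.x t ω) i) ∂P.μ := by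
  let _ := P.m0
  have := P.prob
  have h : ∀ ω, V (P.x (t + 1) ω) = ∑ i, V (step (P.x t ω) i) *
      ({ω' | P.sel t ω' = i} : Set P.Ω).indicator (fun _ => (1 : ℝ)) ω := fun ω => by
    rw [x_succ hP.2, Finset.sum_eq_single (P.sel t ω)]
    · simp
    · intro b _ hb
      simp [hb.symm]
    · simp
  have hi := fun i => integral_indicator_sel hn hP t (fun x => V (step x i)) i
  simp only [h]
  rw [integral_finsetSum _ fun i _ => (hi i).1,
    integral_finsetSum _ fun i _ => integrable_comp hn hP.2 t fun x => V (step x i),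
    Finset.mul_sum]
  exact Finset.sum_congr rfl fun i _ => (hi i).2

lemma integral_le_of_drift_le (hn : 0 < n) {P : AllocProc n} (hP : P.IsPacking)
    {V : (Fin n → ℕ) → ℝ} {K : ℝ} (hV : ∀ x, ∑ i, V (step x i) ≤ n * (V x + K)) (t : ℕ) :
    letI := P.m0
    ∫ ω, V (P.x t ω) ∂P.μ ≤ V 0 + K * t := by
  let _ := P.m0
  have := P.prob
  have hn' : (0 : ℝ) < n := by positivity
  induction t with
  | zero =>
    have h : ∀ ω, P.x 0 ω = 0 := fun ω => funext (P.x_zero ω)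
    simp [h]
  | succ t ih =>
    have h1 : ∫ ω, ∑ i, V (step (P.x t ω) i) ∂P.μ ≤ ∫ ω, n * (V (P.x t ω) + K) ∂P.μ :=
      integral_mono (integrable_comp hn hP.2 t fun x => ∑ i, V (step x i))
        (integrable_comp hn hP.2 t fun x => n * (V x + K)) fun ω => hV _
    rw [integral_const_mul, integral_add (integrable_comp hn hP.2 t V) (integrable_const K)] at h1
    simp only [integral_const, probReal_univ, smul_eq_mul, one_mul] at h1
    rw [integral_succ hn hP, one_div, inv_mul_le_iff₀ hn']
    refine h1.trans (mul_le_mul_of_nonneg_left ?_ hn'.le)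
    push_cast
    linarith

end PackingDrift

open PackingDrift in
/-- **Corollary 3.3.** There exist constants `c, C > 0` such that, for all sufficiently large
`n`, the `Packing` process satisfies `1 + c ≤ E[η^m] ≤ C` for every round `m ≥ 2`, where the
sample efficiency is `η^m = W^m / S^m` and `S^m = m` for `Packing`. -/
theorem packing_sample_efficient :
    ∃ c C : ℝ, 0 < c ∧ 0 < C ∧ ∃ N : ℕ, ∀ n : ℕ, N ≤ n →
      ∀ P : AllocProc n, P.IsPacking →
        ∀ m : ℕ, 2 ≤ m →
          1 + c ≤ ∫ ω, (P.W m ω : ℝ) / m ∂P.μ ∧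
            ∫ ω, (P.W m ω : ℝ) / m ∂P.μ ≤ C := by
  refine ⟨1 / 16, 9, by norm_num, by norm_num, 12, fun n hn P hP m hm => ?_⟩
  let _ := P.m0
  have := P.prob
  have hn0 : 0 < n := by omega
  have hm0 : (0 : ℝ) < m := by positivity
  have hm2 : (2 : ℝ) ≤ m := by exact_mod_cast hm
  have hW := integrable_comp hn0 hP.2 m fun x => ((∑ i, x i : ℕ) : ℝ)
  have hupper := integral_le_of_drift_le hn0 hP (sum_upperPot_step_le hn0) m
  have hlower := integral_le_of_drift_le hn0 hP (V := fun x => -lowerPot x) (K := -(6 / 5))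
    (fun x => by
      rw [Finset.sum_neg_distrib]
      linarith [le_sum_lowerPot_step hn0 x]) m
  have hu0 : upperPot (0 : Fin n → ℕ) = 0 := by simp [upperPot, quad, avg]
  have hl0 : lowerPot (0 : Fin n → ℕ) = 0 := by simp [lowerPot, nearCount]
  have hWu : ∫ ω, (P.W m ω : ℝ) ∂P.μ ≤ ∫ ω, upperPot (P.x m ω) ∂P.μ :=
    integral_mono hW (integrable_comp hn0 hP.2 m upperPot)
      fun ω => le_add_of_nonneg_right (quad_nonneg _)
  have hWl : ∫ ω, lowerPot (P.x m ω) ∂P.μ ≤ ∫ ω, (16 / 15 * (P.W m ω : ℝ) + 2 / 15) ∂P.μ := by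
    refine integral_mono (integrable_comp hn0 hP.2 m lowerPot)
      ((hW.const_mul _).add (integrable_const _)) fun ω => ?_
    have h : 3 * (nearCount n (∑ i, P.x m ω i) : ℝ) ≤ (∑ i, P.x m ω i : ℕ) + 2 := by
      exact_mod_cast nearCount_le hn _
    simp only [lowerPot, AllocProc.W]
    linarith
  have hadd : ∫ ω, (16 / 15 * (P.W m ω : ℝ) + 2 / 15) ∂P.μ =
      16 / 15 * ∫ ω, (P.W m ω : ℝ) ∂P.μ + 2 / 15 := by
    refine (integral_add (hW.const_mul _) (integrable_const _)).trans ?_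
    simp [integral_const_mul, AllocProc.W]
  rw [integral_neg, hl0] at hlower
  rw [hu0] at hupper
  rw [integral_div, le_div_iff₀ hm0, div_le_iff₀ hm0]
  constructor <;> linarith
end
end

section
/- There exists a constant κ > 0 such that, for all sufficiently large n and for any number of rounds m ≥ κ·n·log n, the Packing process on n bins satisfies Gap(m) ≥ (√κ/20)·log n with probability at least 1/2. -/
open MeasureTheory ProbabilityTheory Real Finset
open scoped ENNReal Classical

noncomputable section

/-- Clamping to the unit interval. -/
noncomputable def unitClamp (z : ℝ) : ℝ := min (max z 0) 1

lemma unitClamp_nonneg (z : ℝ) : 0 ≤ unitClamp z := le_min (le_max_right _ _) zero_le_one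

lemma unitClamp_le_one (z : ℝ) : unitClamp z ≤ 1 := min_le_right _ _

lemma unitClamp_of_one_le {z : ℝ} (hz : 1 ≤ z) : unitClamp z = 1 := by
  unfold unitClamp
  rw [max_eq_left (by linarith), min_eq_right hz]

lemma unitClamp_sq_sub_le (z : ℝ) {ε : ℝ} (hε : 0 ≤ ε) :
    unitClamp z ^ 2 - unitClamp (z - ε) ^ 2 ≤ 2 * ε * unitClamp z := by
  have h1 : unitClamp (z - ε) ≤ unitClamp z :=
    min_le_min_right _ (max_le_max_right _ (by linarith))
  have h2 : unitClamp z - ε ≤ unitClamp (z - ε) := by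
    unfold unitClamp
    rcases le_total z 0 with h | h <;> rcases le_total z 1 with h' | h' <;>
      rcases le_total (z - ε) 0 with h3 | h3 <;> rcases le_total (z - ε) 1 with h4 | h4 <;>
      simp [h, h', h3, h4] <;> linarith
  nlinarith [unitClamp_nonneg z, unitClamp_nonneg (z - ε)]

lemma min_sum_le_sum_min {ι : Type*} (s : Finset ι) (f : ι → ℝ) (hf : ∀ i ∈ s, 0 ≤ f i)
    {c : ℝ} (hc : 0 ≤ c) : min (∑ i ∈ s, f i) c ≤ ∑ i ∈ s, min (f i) c := by
  by_cases h : ∃ i ∈ s, c < f i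
  · obtain ⟨i, hi, hci⟩ := h
    refine (min_le_right _ _).trans ?_
    calc c = min (f i) c := (min_eq_right hci.le).symm
      _ ≤ _ := single_le_sum (f := fun i => min (f i) c)
        (fun j hj => le_min (hf j hj) hc) hi
  · push Not at h
    rw [sum_congr rfl fun i hi => min_eq_left (h i hi)]
    exact min_le_left _ _

lemma exp_le_one_add_add_sq {a : ℝ} (ha : a ≤ 0) : Real.exp a ≤ 1 + a + a ^ 2 := by
  rcases le_total (-1) a with h | h
  · have := Real.abs_exp_sub_one_sub_id_le (x := a) (abs_le.2 ⟨h, by linarith⟩)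
    linarith [(abs_le.1 this).2]
  · have := Real.exp_le_one_iff.2 ha
    nlinarith

section Drift

variable {n : ℕ}

/-- The sum of the squared clamped normalized loads. -/
noncomputable def clampPot (y : Fin n → ℝ) : ℝ := ∑ j, unitClamp (y j) ^ 2

/-- The exponential potential, damped by the clamped quadratic potential. -/
noncomputable def dampedPot (α : ℝ) (y : Fin n → ℝ) : ℝ :=
  (∑ j, Real.exp (α * y j)) * Real.exp (-(4 * α ^ 2 / n) * clampPot y)

/-- The normalized loads after putting `d` balls into bin `i`. -/
noncomputable def addBalls (y : Fin n → ℝ) (i : Fin n) (d : ℝ) (j : Fin n) : ℝ :=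
  y j + (if j = i then d else 0) - d / n

lemma clampPot_nonneg (y : Fin n → ℝ) : 0 ≤ clampPot y := sum_nonneg fun _ _ => sq_nonneg _

lemma clampPot_le (y : Fin n → ℝ) : clampPot y ≤ n := by
  calc clampPot y ≤ ∑ _j : Fin n, (1 : ℝ) := sum_le_sum fun j _ =>
        pow_le_one₀ (unitClamp_nonneg _) (unitClamp_le_one _)
    _ = n := by simp

/-- Adding `d` balls to a bin which thereby reaches normalized load at least `1`. -/
lemma clampPot_addBalls_ge (hn : 0 < n) (y : Fin n → ℝ) (i : Fin n) {d : ℝ} (hd : 0 ≤ d)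
    (hi : 1 ≤ y i + d) :
    clampPot y + (1 - unitClamp (y i)) - 2 * (d / n) * (∑ j, unitClamp (y j) + 1)
      ≤ clampPot (addBalls y i d) := by
  set z : Fin n → ℝ := fun j => y j + (if j = i then d else 0) with hz
  have hε : 0 ≤ d / n := by positivity
  have h1 : ∀ j, unitClamp (z j) ^ 2 - unitClamp (addBalls y i d j) ^ 2
      ≤ 2 * (d / n) * unitClamp (z j) := fun j => unitClamp_sq_sub_le (z j) hε
  have hzi : unitClamp (z i) = 1 := unitClamp_of_one_le (by simpa [hz] using hi)
  have hzj : ∀ j ∈ univ.erase i, z j = y j := fun j hj => by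
    simp [hz, (mem_erase.1 hj).1]
  have e1 : ∑ j, unitClamp (z j) ≤ ∑ j, unitClamp (y j) + 1 := by
    rw [← add_sum_erase _ _ (mem_univ i), ← add_sum_erase univ (fun j => unitClamp (y j))
      (mem_univ i), hzi, sum_congr rfl fun j hj => by rw [hzj j hj]]
    linarith [unitClamp_nonneg (y i)]
  have e2 : clampPot z = clampPot y + (1 - unitClamp (y i) ^ 2) := by
    unfold clampPot
    rw [← add_sum_erase _ _ (mem_univ i), ← add_sum_erase univ (fun j => unitClamp (y j) ^ 2)
      (mem_univ i), hzi, sum_congr rfl fun j hj => by rw [hzj j hj]]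
    ring
  have e3 := sum_le_sum fun j (_ : j ∈ univ) => h1 j
  rw [sum_sub_distrib, ← mul_sum] at e3
  change clampPot z - clampPot _ ≤ _ at e3
  have e4 : unitClamp (y i) ^ 2 ≤ unitClamp (y i) := by
    nlinarith [unitClamp_nonneg (y i), unitClamp_le_one (y i)]
  nlinarith [mul_le_mul_of_nonneg_left e1 (by positivity : 0 ≤ 2 * (d / n))]

lemma sum_exp_addBalls (α : ℝ) (y : Fin n → ℝ) (i : Fin n) (d : ℝ) :
    ∑ j, Real.exp (α * addBalls y i d j) = Real.exp (-(α * d / n)) *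
      (∑ j, Real.exp (α * y j) + (Real.exp (α * (y i + d)) - Real.exp (α * y i))) := by
  have : ∀ j, Real.exp (α * addBalls y i d j) = Real.exp (-(α * d / n)) *
      (Real.exp (α * y j) + if j = i then Real.exp (α * (y i + d)) - Real.exp (α * y i) else 0) := by
    intro j
    unfold addBalls
    by_cases h : j = i
    · subst h
      simp only [if_true]
      rw [add_sub_cancel, ← Real.exp_add]
      congr 1; ring
    · simp only [h, if_false, add_zero]
      rw [← Real.exp_add]
      congr 1; ring
  simp_rw [this]
  rw [← mul_sum, sum_add_distrib]
  simp

lemma dampedPot_nonneg (α : ℝ) (y : Fin n → ℝ) : 0 ≤ dampedPot α y :=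
  mul_nonneg (sum_nonneg fun _ _ => (Real.exp_pos _).le) (Real.exp_pos _).le

set_option maxHeartbeats 1000000 in
/-- One-step drift inequality for the damped exponential potential. -/
lemma dampedPot_drift (hn : 12 ≤ n) {α : ℝ} (hα0 : 0 < α) (hα : α ≤ 1 / 30)
    (y : Fin n → ℝ) (hy : ∑ j, y j = 0) (d : Fin n → ℝ)
    (hover : ∀ i, 0 ≤ y i → d i = 1)
    (hunder : ∀ i, y i < 0 → 1 - y i ≤ d i ∧ d i ≤ 2 - y i) :
    (∑ i, dampedPot α (addBalls y i (d i))) / n ≤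
      (1 - 2 * α ^ 2 / n) * dampedPot α y + 2 := by
  have hn0 : 0 < n := by omega
  have hnR : (12 : ℝ) ≤ n := by exact_mod_cast hn
  have hnp : (0 : ℝ) < n := by linarith
  have hd1 : ∀ i, 1 ≤ d i := fun i => by
    rcases le_or_gt 0 (y i) with h | h
    · exact (hover i h).ge
    · linarith [(hunder i h).1]
  have hyd : ∀ i, 1 ≤ y i + d i := fun i => by
    rcases le_or_gt 0 (y i) with h | h
    · linarith [hover i h]
    · linarith [(hunder i h).1]
  set Φ := ∑ j, Real.exp (α * y j) with hΦ
  have hΦ0 : 0 ≤ Φ := sum_nonneg fun _ _ => (Real.exp_pos _).le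
  set S := ∑ j, unitClamp (y j) with hS
  have hS0 : 0 ≤ S := sum_nonneg fun _ _ => unitClamp_nonneg _
  have hSn : S ≤ n := by
    calc S ≤ ∑ _j : Fin n, (1 : ℝ) := sum_le_sum fun j _ => unitClamp_le_one _
      _ = n := by simp
  set U := S / n with hU
  have hU0 : 0 ≤ U := by positivity
  have hU1 : U ≤ 1 := (div_le_one hnp).2 hSn
  have hSU : S = n * U := by rw [hU]; field_simp
  set E := Real.exp (-(4 * α ^ 2 / n) * clampPot y) with hE
  have hE0 : 0 < E := Real.exp_pos _
  have hE1 : E ≤ 1 := Real.exp_le_one_iff.2 (by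
    have := clampPot_nonneg y
    have : 0 ≤ 4 * α ^ 2 / n * clampPot y := by positivity
    linarith)
  set v : Fin n → ℝ := fun i => min (d i - 1) n with hv
  have hv0 : ∀ i, 0 ≤ v i := fun i => le_min (by linarith [hd1 i]) hnp.le
  have hvn : ∀ i, v i ≤ n := fun i => min_le_right _ _
  -- the exponent bound
  set a : Fin n → ℝ := fun i => (-α + 8 * α ^ 2 * U + 8 * α ^ 2 / n
    - 4 * α ^ 2 * (1 - unitClamp (y i)) - (α - 16 * α ^ 2) * v i) / n with ha
  have hα2 : α ^ 2 ≤ α / 30 := by nlinarith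
  have h8n : 8 * α ^ 2 / n ≤ α ^ 2 := by
    rw [div_le_iff₀ hnp]; nlinarith [sq_nonneg α]
  have h8n0 : 0 ≤ 8 * α ^ 2 / n := by positivity
  have ha0 : ∀ i, a i ≤ 0 := fun i => by
    refine div_nonpos_of_nonpos_of_nonneg ?_ hnp.le
    have h1 := hv0 i
    have h2 : 0 ≤ (α - 16 * α ^ 2) * v i := mul_nonneg (by linarith) h1
    have h3 : 0 ≤ 4 * α ^ 2 * (1 - unitClamp (y i)) :=
      mul_nonneg (by positivity) (by linarith [unitClamp_le_one (y i)])
    nlinarith [mul_le_mul_of_nonneg_left hU1 (by positivity : 0 ≤ 8 * α ^ 2)]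
  have hstep : ∀ i, dampedPot α (addBalls y i (d i)) ≤
      E * (Real.exp (a i) * Φ + (Real.exp (α * y i) * (Real.exp α - 1) + 2)) := by
    intro i
    have hX : Real.exp (α * (y i + d i)) - Real.exp (α * y i) ≤
        Real.exp (α * y i) * (Real.exp α - 1) + 2 := by
      rcases le_or_gt 0 (y i) with h | h
      · rw [hover i h, mul_add, Real.exp_add]
        simp only [mul_one]
        linarith
      · have h1 : Real.exp (α * (y i + d i)) ≤ 2 := by
          calc Real.exp (α * (y i + d i)) ≤ Real.exp (1 / 2) := by
                apply Real.exp_le_exp.2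
                nlinarith [(hunder i h).2]
            _ ≤ 2 := by
                have := Real.abs_exp_sub_one_sub_id_le (x := 1 / 2) (by norm_num [abs_of_pos])
                have := (abs_le.1 this).2
                norm_num at this ⊢
                linarith
        have h2 : 0 ≤ Real.exp (α * y i) * Real.exp α := by positivity
        linarith
    have hX0 : 0 ≤ Real.exp (α * y i) * (Real.exp α - 1) + 2 := by
      have : 1 ≤ Real.exp α := Real.one_le_exp hα0.le
      have : 0 ≤ Real.exp (α * y i) * (Real.exp α - 1) :=
        mul_nonneg (Real.exp_pos _).le (by linarith)
      linarith
    have hexp : Real.exp (-(α * d i / n)) *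
        Real.exp (-(4 * α ^ 2 / n) * clampPot (addBalls y i (d i))) ≤ E * Real.exp (a i) := by
      rw [hE, ← Real.exp_add, ← Real.exp_add]
      apply Real.exp_le_exp.2
      have h1 := clampPot_addBalls_ge hn0 y i (by linarith [hd1 i] : 0 ≤ d i) (hyd i)
      have hc : 0 ≤ 4 * α ^ 2 / n := by positivity
      have h2 := mul_le_mul_of_nonneg_left h1 hc
      have h3 : -(α * d i / n) - 4 * α ^ 2 / n * ((1 - unitClamp (y i))
          - 2 * (d i / n) * (S + 1)) ≤ a i := by
        have e : -(α * d i / n) - 4 * α ^ 2 / n * ((1 - unitClamp (y i))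
          - 2 * (d i / n) * (S + 1)) = (-α * d i - 4 * α ^ 2 * (1 - unitClamp (y i))
            + 8 * α ^ 2 * d i * (U + 1 / n)) / n := by
          rw [hU]; field_simp; ring
        rw [e, ha]
        apply div_le_div_of_nonneg_right _ hnp.le
        have h4 : v i ≤ d i - 1 := min_le_left _ _
        have h5 : (1 : ℝ) / n ≤ 1 := (div_le_one hnp).2 (by linarith)
        have h6 : 8 * α ^ 2 / n = 8 * α ^ 2 * (1 / n) := by ring
        rw [h6]
        have h7 : (α - 16 * α ^ 2) * v i ≤ (α - 16 * α ^ 2) * (d i - 1) :=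
          mul_le_mul_of_nonneg_left h4 (by linarith)
        have h8 : 8 * α ^ 2 * ((d i - 1) * (U + 1 / n)) ≤ 8 * α ^ 2 * ((d i - 1) * 2) :=
          mul_le_mul_of_nonneg_left (mul_le_mul_of_nonneg_left (by linarith)
            (by linarith [hd1 i])) (by positivity)
        nlinarith
      nlinarith
    have hX' : 0 ≤ Φ + (Real.exp (α * y i) * (Real.exp α - 1) + 2) := by linarith
    calc dampedPot α (addBalls y i (d i))
        = (Real.exp (-(α * d i / n)) *
          Real.exp (-(4 * α ^ 2 / n) * clampPot (addBalls y i (d i)))) *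
          (Φ + (Real.exp (α * (y i + d i)) - Real.exp (α * y i))) := by
          rw [dampedPot, sum_exp_addBalls]; ring
      _ ≤ (Real.exp (-(α * d i / n)) *
          Real.exp (-(4 * α ^ 2 / n) * clampPot (addBalls y i (d i)))) *
          (Φ + (Real.exp (α * y i) * (Real.exp α - 1) + 2)) := by gcongr
      _ ≤ (E * Real.exp (a i)) * (Φ + (Real.exp (α * y i) * (Real.exp α - 1) + 2)) :=
          mul_le_mul_of_nonneg_right hexp hX'
      _ ≤ _ := by
          have : Real.exp (a i) * (Real.exp (α * y i) * (Real.exp α - 1) + 2) ≤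
              1 * (Real.exp (α * y i) * (Real.exp α - 1) + 2) :=
            mul_le_mul_of_nonneg_right (Real.exp_le_one_iff.2 (ha0 i)) hX0
          rw [mul_assoc]
          apply mul_le_mul_of_nonneg_left _ hE0.le
          linarith
  -- the underload is at least the clamped overload
  have hvU : n * U ≤ ∑ i, v i := by
    have h1 : ∑ i, max (y i) 0 = ∑ i, max (-(y i)) 0 := by
      rw [← sub_eq_zero, ← sum_sub_distrib]
      simp_rw [max_zero_sub_max_neg_zero_eq_self]
      exact hy
    have h2 : S ≤ ∑ i, max (y i) 0 := sum_le_sum fun i _ => min_le_left _ _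
    have h3 := min_sum_le_sum_min univ (fun i => max (-(y i)) 0)
      (fun i _ => le_max_right _ _) hnp.le
    rw [← hSU]
    refine (le_min (h2.trans h1.le) hSn).trans (h3.trans (sum_le_sum fun i _ => ?_))
    refine min_le_min_right _ (max_le ?_ (by linarith [hd1 i]))
    linarith [hyd i]
  set V := (∑ i, v i) / n with hV
  have hVU : U ≤ V := by rw [hV, le_div_iff₀ hnp]; linarith
  have hexpa : ∀ i, Real.exp (a i) ≤ 1 + (-α + 8 * α ^ 2 * U + 12 * α ^ 2 / n
      - 4 * α ^ 2 * (1 - unitClamp (y i)) - (α - 18 * α ^ 2) * v i) / n := by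
    intro i
    refine (exp_le_one_add_add_sq (ha0 i)).trans ?_
    have h1 : -(2 * α + α * v i) / n ≤ a i := by
      rw [ha]
      apply div_le_div_of_nonneg_right _ hnp.le
      nlinarith [hv0 i, unitClamp_nonneg (y i), sq_nonneg α, mul_nonneg (sq_nonneg α) (hv0 i),
        mul_nonneg (sq_nonneg α) hU0, mul_nonneg (sq_nonneg α) (unitClamp_nonneg (y i))]
    have h2 : a i ^ 2 ≤ ((2 * α + α * v i) / n) ^ 2 := by
      apply sq_le_sq'
      · rw [← neg_div]; exact h1
      · have : 0 ≤ (2 * α + α * v i) / n := by have := hv0 i; positivity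
        linarith [ha0 i]
    have h3 : ((2 * α + α * v i) / n) ^ 2 ≤ (4 * α ^ 2 / n + 2 * α ^ 2 * v i) / n := by
      have e : (4 * α ^ 2 / n + 2 * α ^ 2 * v i) / n
        = (α ^ 2 * (4 + 2 * v i * n)) / n ^ 2 := by field_simp
      rw [e, div_pow]
      apply div_le_div_of_nonneg_right _ (by positivity)
      have : 4 + 4 * v i + v i * v i ≤ 4 + 2 * v i * n := by nlinarith [hv0 i, hvn i]
      nlinarith [mul_le_mul_of_nonneg_left this (sq_nonneg α)]
    have e : 1 + (-α + 8 * α ^ 2 * U + 12 * α ^ 2 / n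
      - 4 * α ^ 2 * (1 - unitClamp (y i)) - (α - 18 * α ^ 2) * v i) / n
      = 1 + a i + (4 * α ^ 2 / n + 2 * α ^ 2 * v i) / n := by
      rw [ha]; ring
    rw [e]
    linarith
  have hsumexp : (∑ i, Real.exp (a i)) / n ≤ 1 + (-α - 3 * α ^ 2) / n := by
    have h1 := sum_le_sum fun i (_ : i ∈ univ) => hexpa i
    have h2 : ∑ i, (1 + (-α + 8 * α ^ 2 * U + 12 * α ^ 2 / n
      - 4 * α ^ 2 * (1 - unitClamp (y i)) - (α - 18 * α ^ 2) * v i) / n)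
      = n * (1 + (-α + 8 * α ^ 2 * U + 12 * α ^ 2 / n
      - 4 * α ^ 2 * (1 - U) - (α - 18 * α ^ 2) * V) / n) := by
      have e1 : ∀ i, (1 + (-α + 8 * α ^ 2 * U + 12 * α ^ 2 / n
        - 4 * α ^ 2 * (1 - unitClamp (y i)) - (α - 18 * α ^ 2) * v i) / n)
        = (1 + (-α + 8 * α ^ 2 * U + 12 * α ^ 2 / n - 4 * α ^ 2) / n)
          + (4 * α ^ 2 / n) * unitClamp (y i) - ((α - 18 * α ^ 2) / n) * v i := fun i => by ring
      simp_rw [e1]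
      rw [sum_sub_distrib, sum_add_distrib, ← mul_sum, ← mul_sum, ← hS]
      have e2 : ∑ i, v i = n * V := by rw [hV]; field_simp
      rw [e2, hSU, sum_const, card_univ, Fintype.card_fin, nsmul_eq_mul]
      field_simp
      ring
    rw [h2] at h1
    rw [div_le_iff₀ hnp, mul_comm _ (n : ℝ)]
    refine h1.trans (mul_le_mul_of_nonneg_left ?_ hnp.le)
    have h12 : 12 * α ^ 2 / n ≤ α ^ 2 := by
      rw [div_le_iff₀ hnp]; nlinarith [sq_nonneg α]
    have h3 : (α - 18 * α ^ 2) * U ≤ (α - 18 * α ^ 2) * V :=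
      mul_le_mul_of_nonneg_left hVU (by linarith)
    have h4 : (12 * α ^ 2) * U ≤ (α - 18 * α ^ 2) * U :=
      mul_le_mul_of_nonneg_right (by linarith) hU0
    have : (-α + 8 * α ^ 2 * U + 12 * α ^ 2 / n
      - 4 * α ^ 2 * (1 - U) - (α - 18 * α ^ 2) * V) / n ≤ (-α - 3 * α ^ 2) / n :=
      div_le_div_of_nonneg_right (by linarith) hnp.le
    linarith
  have hexpα : Real.exp α - 1 ≤ α + α ^ 2 := by
    have := Real.abs_exp_sub_one_sub_id_le (x := α) (abs_le.2 ⟨by linarith, by linarith⟩)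
    linarith [(abs_le.1 this).2]
  calc (∑ i, dampedPot α (addBalls y i (d i))) / n
      ≤ (∑ i, E * (Real.exp (a i) * Φ + (Real.exp (α * y i) * (Real.exp α - 1) + 2))) / n :=
        div_le_div_of_nonneg_right (sum_le_sum fun i _ => hstep i) hnp.le
    _ = E * ((∑ i, Real.exp (a i)) / n * Φ + (Real.exp α - 1) / n * Φ + 2) := by
        rw [← mul_sum, sum_add_distrib, sum_add_distrib, ← sum_mul, ← sum_mul, ← hΦ]
        simp only [sum_const, card_univ, Fintype.card_fin, nsmul_eq_mul]
        field_simp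
        ring
    _ ≤ E * ((1 + (-α - 3 * α ^ 2) / n) * Φ + (α + α ^ 2) / n * Φ + 2) := by
        have h1 := mul_le_mul_of_nonneg_right hsumexp hΦ0
        have h2 := mul_le_mul_of_nonneg_right
          (div_le_div_of_nonneg_right hexpα hnp.le) hΦ0
        exact mul_le_mul_of_nonneg_left (by linarith) hE0.le
    _ = (1 - 2 * α ^ 2 / n) * (Φ * E) + 2 * E := by ring
    _ ≤ (1 - 2 * α ^ 2 / n) * dampedPot α y + 2 := by
        rw [dampedPot, ← hΦ, ← hE]; linarith

end Drift

namespace AllocProc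

variable {n : ℕ} (P : AllocProc n)

section Sampling

variable {P}

instance : MeasurableSpace P.Ω := P.m0

instance : IsProbabilityMeasure P.μ := P.prob

lemma measurableSet_sel_eq (t : ℕ) (i : Fin n) : MeasurableSet {ω | P.sel t ω = i} :=
  P.F.le (t + 1) _ (P.meas_sel t (measurableSet_singleton i))

lemma UniformSampling.measure_inter (h : P.UniformSampling) (t : ℕ) (i : Fin n) {B : Set P.Ω}
    (hB : MeasurableSet[P.F t] B) : P.μ (B ∩ {ω | P.sel t ω = i}) = P.μ B / n := by
  have hn : 0 < n := i.pos
  have hA := measurableSet_sel_eq (P := P) t i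
  have hsel : Integrable (({ω | P.sel t ω = i} : Set P.Ω).indicator fun _ => (1 : ℝ)) P.μ :=
    (integrable_const _).indicator hA
  have h1 := setIntegral_condExp (P.F.le t) hsel hB
  rw [setIntegral_congr_ae (g := fun _ => (1 : ℝ) / n) (P.F.le t _ hB)
    ((h t i).mono fun ω hω _ => hω), setIntegral_indicator hA] at h1
  simp only [setIntegral_const, smul_eq_mul, mul_one] at h1
  rw [← ENNReal.toReal_eq_toReal_iff' (measure_ne_top _ _)
    (ENNReal.div_ne_top (measure_ne_top _ _) (by positivity)), ENNReal.toReal_div]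
  simp only [ENNReal.toReal_natCast]
  rw [← Measure.real, ← Measure.real, ← h1]
  ring

lemma UniformSampling.setLIntegral (h : P.UniformSampling) (t : ℕ) (i : Fin n)
    {g : P.Ω → ℝ≥0∞} (hg : Measurable[P.F t] g) :
    ∫⁻ ω in {ω | P.sel t ω = i}, g ω ∂P.μ = (∫⁻ ω, g ω ∂P.μ) / n := by
  have hm := P.F.le t
  have key : (P.μ.restrict {ω | P.sel t ω = i}).trim hm = (n : ℝ≥0∞)⁻¹ • P.μ.trim hm := by
    refine @Measure.ext _ (P.F t) _ _ fun B hB => ?_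
    rw [trim_measurableSet_eq hm hB, Measure.restrict_apply (hm _ hB), h.measure_inter t i hB,
      Measure.smul_apply, trim_measurableSet_eq hm hB, smul_eq_mul, mul_comm, div_eq_mul_inv]
  rw [← lintegral_trim hm hg, key, lintegral_smul_measure, lintegral_trim hm hg, smul_eq_mul,
    mul_comm, div_eq_mul_inv]

lemma measurable_x (t : ℕ) : Measurable[P.F t] (P.x t) :=
  @measurable_pi_lambda _ _ _ (P.F t) _ _ fun i => P.meas_x t i

lemma UniformSampling.lintegral_sel (h : P.UniformSampling) (t : ℕ)
    (f : (Fin n → ℕ) → Fin n → ℝ≥0∞) :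
    ∫⁻ ω, f (P.x t ω) (P.sel t ω) ∂P.μ = ∫⁻ ω, (∑ i, f (P.x t ω) i) / n ∂P.μ := by
  have hf : ∀ i, Measurable[P.F t] fun ω => f (P.x t ω) i := fun i =>
    (Measurable.of_discrete (f := fun x => f x i)).comp (measurable_x t)
  have hf' : ∀ i, Measurable fun ω => f (P.x t ω) i := fun i => (hf i).mono (P.F.le t) le_rfl
  have e1 : ∀ ω, f (P.x t ω) (P.sel t ω) = ∑ i, ({ω | P.sel t ω = i} : Set P.Ω).indicator
      (fun ω => f (P.x t ω) i) ω := fun ω => by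
    simp [Set.indicator_apply]
  simp_rw [e1, div_eq_mul_inv]
  rw [lintegral_finsetSum _ fun i _ => (hf' i).indicator (measurableSet_sel_eq t i),
    lintegral_mul_const _ (Finset.measurable_sum _ fun i _ => hf' i),
    lintegral_finsetSum _ fun i _ => hf' i, sum_mul]
  refine sum_congr rfl fun i _ => ?_
  rw [lintegral_indicator (measurableSet_sel_eq t i), h.setLIntegral t i (hf i), div_eq_mul_inv]

/-- The samples of any `T` consecutive rounds are jointly uniform. -/
lemma UniformSampling.measure_seq_eq (h : P.UniformSampling) (t : ℕ) :
    ∀ (T : ℕ) (a : Fin T → Fin n),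
      P.μ {ω | (fun s : Fin T => P.sel (t + s) ω) = a} = ((n : ℝ≥0∞) ^ T)⁻¹
  | 0, a => by
    have : {ω | (fun s : Fin 0 => P.sel (t + s) ω) = a} = Set.univ :=
      Set.eq_univ_of_forall fun ω => Subsingleton.elim _ _
    rw [this]; simp
  | T + 1, a => by
    have e : {ω | (fun s : Fin (T + 1) => P.sel (t + s) ω) = a} =
        {ω | (fun s : Fin T => P.sel (t + s) ω) = fun s => a s.castSucc} ∩
          {ω | P.sel (t + T) ω = a (Fin.last T)} := by
      ext ω
      simp only [Set.mem_ofPred_eq, Set.mem_inter_iff, funext_iff, Fin.forall_fin_succ']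
      simp
    have hB : MeasurableSet[P.F (t + T)]
        {ω | (fun s : Fin T => P.sel (t + s) ω) = fun s => a s.castSucc} := by
      have e2 : {ω | (fun s : Fin T => P.sel (t + s) ω) = fun s => a s.castSucc} =
          ⋂ s : Fin T, {ω | P.sel (t + s) ω = a s.castSucc} := by
        ext ω; simp [funext_iff]
      rw [e2]
      refine MeasurableSet.iInter fun s => ?_
      exact P.F.mono (by omega : t + (s : ℕ) + 1 ≤ t + T) _
        (P.meas_sel (t + s) (measurableSet_singleton _))
    rw [e, h.measure_inter _ _ hB, h.measure_seq_eq t T, pow_succ, div_eq_mul_inv,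
      ENNReal.mul_inv (Or.inr (by simp)) (Or.inl (by simp))]

lemma UniformSampling.measure_seq_mem_le (h : P.UniformSampling) (t T : ℕ)
    (S : Finset (Fin T → Fin n)) :
    P.μ {ω | (fun s : Fin T => P.sel (t + s) ω) ∈ S} ≤ (S.card : ℝ≥0∞) / (n : ℝ≥0∞) ^ T := by
  have e : {ω | (fun s : Fin T => P.sel (t + s) ω) ∈ S} =
      ⋃ a ∈ S, {ω | (fun s : Fin T => P.sel (t + s) ω) = a} := by
    ext ω; simp
  rw [e]
  refine (measure_biUnion_finset_le _ _).trans ?_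
  simp_rw [h.measure_seq_eq, sum_const, nsmul_eq_mul, div_eq_mul_inv]
  exact le_rfl

end Sampling

end AllocProc

section SecondMoment

/-- Second moment method for `n` subsets of the same size which are pairwise nonpositively
correlated under the uniform distribution. -/
lemma card_avoid_mul_le {Ω ι : Type*} [Fintype Ω] [DecidableEq Ω] [Fintype ι] [DecidableEq ι]
    (G : ι → Finset Ω) (p : ℝ) (hp : 0 ≤ p)
    (hG : ∀ i, ((G i).card : ℝ) = p * Fintype.card Ω)
    (hGG : ∀ i j, i ≠ j → ((G i ∩ G j).card : ℝ) ≤ p ^ 2 * Fintype.card Ω) :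
    ((univ.filter fun ω => ∀ i, ω ∉ G i).card : ℝ) * (Fintype.card ι * p) ≤ Fintype.card Ω := by
  set K : ℝ := (Fintype.card Ω : ℝ) with hK
  set n : ℝ := (Fintype.card ι : ℝ) with hn
  have hn0 : 0 ≤ n := Nat.cast_nonneg _
  have hK0 : 0 ≤ K := Nat.cast_nonneg _
  set N : Ω → ℝ := fun ω => ∑ i, if ω ∈ G i then 1 else 0 with hN
  have s1 : ∑ ω, N ω = n * (p * K) := by
    rw [hN, sum_comm]
    simp only [sum_boole, filter_univ_mem, hG, sum_const, card_univ,
      nsmul_eq_mul]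
    rfl
  have s2 : ∑ ω, N ω ^ 2 ≤ n * (p * K) + n ^ 2 * (p ^ 2 * K) := by
    have e : ∑ ω, N ω ^ 2 = ∑ i, ∑ j, ((G i ∩ G j).card : ℝ) := by
      simp_rw [hN, sq, sum_mul_sum]
      rw [sum_comm]
      refine sum_congr rfl fun i _ => ?_
      rw [sum_comm]
      refine sum_congr rfl fun j _ => ?_
      simp [← ite_and, ← mem_inter, inter_comm]
    rw [e]
    have e2 : ∀ i j, ((G i ∩ G j).card : ℝ) ≤ (if i = j then p * K else 0) + p ^ 2 * K := by
      intro i j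
      by_cases h : i = j
      · subst h
        simp only [inter_self, if_true, hG]
        have : 0 ≤ p ^ 2 * K := by positivity
        linarith
      · simpa [h] using hGG i j h
    refine (sum_le_sum fun i _ => sum_le_sum fun j _ => e2 i j).trans ?_
    simp [sum_add_distrib, hn]
    apply le_of_eq; ring
  have s3 : ∑ ω, (N ω - n * p) ^ 2 ≤ n * (p * K) := by
    have e : ∑ ω, (N ω - n * p) ^ 2 = ∑ ω, N ω ^ 2 - 2 * (n * p) * ∑ ω, N ω + K * (n * p) ^ 2 := by
      simp_rw [sub_sq, sum_add_distrib, sum_sub_distrib, mul_sum]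
      simp only [sum_const, card_univ, nsmul_eq_mul]
      congr 2
      exact sum_congr rfl fun _ _ => by ring
    rw [e, s1]
    linarith
  have s4 : ((univ.filter fun ω => ∀ i, ω ∉ G i).card : ℝ) * (n * p) ^ 2 ≤ n * (p * K) := by
    refine le_trans ?_ s3
    rw [← nsmul_eq_mul, ← sum_const]
    refine le_trans (sum_le_sum fun ω hω => ?_)
      (sum_le_sum_of_subset_of_nonneg (filter_subset _ _) fun _ _ _ => sq_nonneg _)
    have hω' := (mem_filter.1 hω).2
    have : N ω = 0 := by simp [hN, hω']
    rw [this]; simp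
  rcases (mul_nonneg hn0 hp).eq_or_lt with h | h
  · rw [← h, mul_zero]; exact hK0
  · have : (((univ.filter fun ω => ∀ i, ω ∉ G i).card : ℝ) * (n * p)) * (n * p) ≤ K * (n * p) := by
      linarith
    exact le_of_mul_le_mul_right this h

variable {n ℓ k : ℕ}

/-- The sample sequences of length `ℓ` hitting bin `i`. -/
def hitting (ℓ : ℕ) (i : Fin n) : Finset (Fin ℓ → Fin n) := univ.filter fun b => ∃ r, b r = i

lemma card_filter_avoid (s : Finset (Fin n)) :
    (univ.filter fun b : Fin ℓ → Fin n => ∀ r, b r ∉ s).card = (n - s.card) ^ ℓ := by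
  have : (univ.filter fun b : Fin ℓ → Fin n => ∀ r, b r ∉ s) =
      Fintype.piFinset fun _ => sᶜ := by
    ext b; simp
  rw [this]; simp [card_compl]

lemma card_hitting (hn : 2 ≤ n) (i : Fin n) :
    ((hitting ℓ i).card : ℝ) = (1 - (1 - 1 / (n : ℝ)) ^ ℓ) * n ^ ℓ := by
  have h1 := card_filter_add_card_filter_not (s := (univ : Finset (Fin ℓ → Fin n)))
    (p := fun b => ∃ r, b r = i)
  have h2 := card_filter_avoid (ℓ := ℓ) ({i} : Finset (Fin n))
  simp only [mem_singleton, card_singleton] at h2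
  simp only [not_exists] at h1
  rw [h2, card_univ, Fintype.card_fun, Fintype.card_fin, Fintype.card_fin] at h1
  have hn0 : (n : ℝ) ≠ 0 := by positivity
  have h3 : ((hitting ℓ i).card : ℝ) + ((n : ℝ) - 1) ^ ℓ = n ^ ℓ := by
    rw [← Nat.cast_pow n, ← h1, hitting]; push_cast [Nat.cast_sub (by omega : 1 ≤ n)]; rfl
  rw [sub_mul, ← mul_pow, sub_mul, one_div_mul_cancel hn0, one_mul, one_mul]
  linarith

lemma card_hitting_inter_le (hn : 2 ≤ n) {i j : Fin n} (hij : i ≠ j) :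
    ((hitting ℓ i ∩ hitting ℓ j).card : ℝ) ≤ (1 - (1 - 1 / (n : ℝ)) ^ ℓ) ^ 2 * n ^ ℓ := by
  have hU : (hitting ℓ i ∪ hitting ℓ j)ᶜ =
      univ.filter fun b : Fin ℓ → Fin n => ∀ r, b r ∉ ({i, j} : Finset (Fin n)) := by
    ext b
    simp only [hitting, mem_compl, mem_union, mem_filter, mem_univ, true_and, mem_insert,
      mem_singleton]
    push Not
    exact ⟨fun h r => ⟨h.1 r, h.2 r⟩, fun h => ⟨fun r => (h r).1, fun r => (h r).2⟩⟩
  have h1 := card_compl_add_card (hitting ℓ i ∪ hitting ℓ j)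
  rw [hU, card_filter_avoid, card_pair hij, Fintype.card_fun, Fintype.card_fin,
    Fintype.card_fin] at h1
  have h2 := card_union_add_card_inter (hitting ℓ i) (hitting ℓ j)
  have h1' : ((n : ℝ) - 2) ^ ℓ + ((hitting ℓ i ∪ hitting ℓ j).card : ℝ) = n ^ ℓ := by
    rw [← Nat.cast_pow n, ← h1]; push_cast [Nat.cast_sub hn]; rfl
  have h2' : ((hitting ℓ i ∪ hitting ℓ j).card : ℝ) + ((hitting ℓ i ∩ hitting ℓ j).card : ℝ)
      = (hitting ℓ i).card + (hitting ℓ j).card := by exact_mod_cast h2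
  rw [card_hitting hn, card_hitting hn] at h2'
  have hnR : (2 : ℝ) ≤ n := by exact_mod_cast hn
  have hnp : (0 : ℝ) < n := by linarith
  have h3 : ((n : ℝ) - 2) ^ ℓ ≤ ((1 - 1 / (n : ℝ)) ^ ℓ) ^ 2 * n ^ ℓ := by
    rw [← pow_mul, mul_comm ℓ 2, pow_mul, ← mul_pow]
    apply pow_le_pow_left₀ (by linarith)
    have : (1 - 1 / (n : ℝ)) ^ 2 * n = n - 2 + 1 / n := by field_simp; ring
    rw [this]
    have : 0 ≤ 1 / (n : ℝ) := by positivity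
    linarith
  nlinarith

/-- Among sequences of `k` blocks of `ℓ` uniform samples, few leave every bin unsampled in
some block. -/
lemma card_no_bin_hit_in_every_block (hn : 2 ≤ n) :
    ((univ.filter fun b : Fin k → Fin ℓ → Fin n => ∀ i, ∃ j, ∀ r, b j r ≠ i).card : ℝ) *
      (n * (1 - (1 - 1 / (n : ℝ)) ^ ℓ) ^ k) ≤ n ^ (k * ℓ) := by
  have hnR : (2 : ℝ) ≤ n := by exact_mod_cast hn
  set q : ℝ := 1 - (1 - 1 / (n : ℝ)) ^ ℓ with hq
  have h1n : 1 / (n : ℝ) ≤ 1 := (div_le_one (by linarith)).2 (by linarith)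
  have h1n' : 0 ≤ 1 / (n : ℝ) := by positivity
  have hq0 : 0 ≤ q := by
    have : (1 - 1 / (n : ℝ)) ^ ℓ ≤ 1 := pow_le_one₀ (by linarith) (by linarith)
    linarith
  have hcard : (Fintype.card (Fin k → Fin ℓ → Fin n) : ℝ) = ((n : ℝ) ^ ℓ) ^ k := by simp
  have := card_avoid_mul_le (fun i : Fin n => Fintype.piFinset fun _ : Fin k => hitting ℓ i)
    (q ^ k) (pow_nonneg hq0 k)
    (fun i => by
      rw [Fintype.card_piFinset_const, Nat.cast_pow, card_hitting hn, mul_pow, hcard])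
    (fun i j hij => by
      have e : (Fintype.piFinset fun _ : Fin k => hitting ℓ i) ∩
          (Fintype.piFinset fun _ : Fin k => hitting ℓ j) =
          Fintype.piFinset fun _ : Fin k => hitting ℓ i ∩ hitting ℓ j := by
        ext b; simp [forall_and]
      rw [e, Fintype.card_piFinset_const, Nat.cast_pow, hcard, ← pow_mul, mul_comm k 2, pow_mul,
        ← mul_pow]
      exact pow_le_pow_left₀ (Nat.cast_nonneg _) (card_hitting_inter_le hn hij) k)
  rw [hcard, Fintype.card_fin, ← pow_mul, mul_comm ℓ k] at this
  refine le_trans (le_of_eq ?_) this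
  congr 3
  ext b
  simp [hitting]

end SecondMoment

namespace AllocProc

variable {n : ℕ} {P : AllocProc n}

section Packing

/-- The average of a load vector. -/
def avgLoad (x : Fin n → ℕ) : ℝ := ((∑ i, x i : ℕ) : ℝ) / n

/-- The number of balls which `Packing` allocates to the sampled bin `i`. -/
def packingInc (x : Fin n → ℕ) (i : Fin n) : ℕ :=
  if avgLoad x ≤ x i then 1 else ⌈avgLoad x⌉₊ + 1 - x i

lemma avgLoad_nonneg (x : Fin n → ℕ) : 0 ≤ avgLoad x := by unfold avgLoad; positivity

lemma packingInc_of_le {x : Fin n → ℕ} {i : Fin n} (h : avgLoad x ≤ x i) : packingInc x i = 1 :=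
  if_pos h

lemma add_packingInc_of_lt {x : Fin n → ℕ} {i : Fin n} (h : (x i : ℝ) < avgLoad x) :
    x i + packingInc x i = ⌈avgLoad x⌉₊ + 1 := by
  have h1 : x i < ⌈avgLoad x⌉₊ := Nat.lt_ceil.2 h
  rw [packingInc, if_neg (not_le.2 h)]
  omega

lemma packingInc_bounds {x : Fin n → ℕ} {i : Fin n} (h : (x i : ℝ) < avgLoad x) :
    1 - ((x i : ℝ) - avgLoad x) ≤ packingInc x i ∧
      (packingInc x i : ℝ) ≤ 2 - ((x i : ℝ) - avgLoad x) := by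
  have h1 : (x i : ℝ) + packingInc x i = ⌈avgLoad x⌉₊ + 1 := by
    exact_mod_cast add_packingInc_of_lt h
  have h2 := Nat.le_ceil (avgLoad x)
  have h3 := Nat.ceil_lt_add_one (avgLoad_nonneg x)
  constructor <;> linarith

lemma PackingRule.x_succ (h : P.PackingRule) (t : ℕ) (ω : P.Ω) (j : Fin n) :
    P.x (t + 1) ω j = P.x t ω j +
      if j = P.sel t ω then packingInc (P.x t ω) (P.sel t ω) else 0 := by
  rw [h t ω j]
  by_cases hj : j = P.sel t ω
  · rw [if_pos hj, if_pos hj, ← hj]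
    rcases le_or_gt (avgLoad (P.x t ω)) (P.x t ω j) with h1 | h1
    · rw [packingInc_of_le h1]; exact if_pos h1
    · rw [add_packingInc_of_lt h1]; exact if_neg (not_le.2 h1)
  · simp [hj]

lemma PackingRule.W_succ (h : P.PackingRule) (t : ℕ) (ω : P.Ω) :
    P.W (t + 1) ω = P.W t ω + packingInc (P.x t ω) (P.sel t ω) := by
  unfold W
  simp_rw [h.x_succ t ω, sum_add_distrib]
  simp

/-- The normalized loads of a load vector. -/
def normLoad (x : Fin n → ℕ) (i : Fin n) : ℝ := (x i : ℝ) - avgLoad x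

lemma sum_normLoad (hn : 0 < n) (x : Fin n → ℕ) : ∑ i, normLoad x i = 0 := by
  unfold normLoad avgLoad
  rw [sum_sub_distrib]
  simp
  field_simp
  simp

lemma PackingRule.normLoad_succ (h : P.PackingRule) (t : ℕ) (ω : P.Ω) :
    normLoad (P.x (t + 1) ω) = addBalls (normLoad (P.x t ω)) (P.sel t ω)
      (packingInc (P.x t ω) (P.sel t ω)) := by
  ext j
  have hW := h.W_succ t ω
  have e : ∀ t, avgLoad (P.x t ω) = (P.W t ω : ℝ) / n := fun t => rfl
  simp only [normLoad, addBalls, e, h.x_succ t ω j, hW]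
  push_cast
  ring

lemma packing_drift (hn : 12 ≤ n) (x : Fin n → ℕ) :
    (∑ i, dampedPot (1 / 30) (addBalls (normLoad x) i (packingInc x i))) / n ≤
      (1 - 1 / (450 * n)) * dampedPot (1 / 30) (normLoad x) + 2 := by
  refine (dampedPot_drift hn (by norm_num) le_rfl (normLoad x) (sum_normLoad (by omega) x) _
    (fun i hi => ?_) fun i hi => packingInc_bounds (sub_neg.1 hi)).trans (le_of_eq ?_)
  · rw [packingInc_of_le (sub_nonneg.1 hi), Nat.cast_one]
  · ring

/-- The expected number of balls in one round of `Packing`, in terms of the potential. -/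
lemma packingInc_avg_le (hn : 0 < n) (x : Fin n → ℕ) :
    (∑ i, (packingInc x i : ℝ)) / n ≤ 2 + 60 / n * dampedPot (1 / 30) (normLoad x) := by
  have hnp : (0 : ℝ) < n := by exact_mod_cast hn
  set y := normLoad x with hy
  have h1 : ∀ i, (packingInc x i : ℝ) ≤ 2 + max (y i) 0 - y i := by
    intro i
    rcases le_or_gt 0 (y i) with h | h
    · rw [packingInc_of_le (sub_nonneg.1 h), max_eq_left h]; norm_num
    · have h' : (packingInc x i : ℝ) ≤ 2 - y i := (packingInc_bounds (sub_neg.1 h)).2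
      rw [max_eq_right h.le]
      linarith
  have h2 : ∀ i, max (y i) 0 ≤ 30 * Real.exp (1 / 30 * y i) := fun i =>
    max_le (by linarith [Real.add_one_le_exp (1 / 30 * y i)]) (by positivity)
  have h3 : ∑ i, (packingInc x i : ℝ) ≤ ∑ i, ((2 + 30 * Real.exp (1 / 30 * y i)) - y i) :=
    sum_le_sum fun i _ => by linarith [h1 i, h2 i]
  rw [sum_sub_distrib, hy, sum_normLoad hn x, ← hy, sum_add_distrib, ← mul_sum] at h3
  simp only [sum_const, card_univ, Fintype.card_fin, nsmul_eq_mul, sub_zero] at h3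
  have h4 : ∑ i, Real.exp (1 / 30 * y i) ≤ 2 * dampedPot (1 / 30) y := by
    unfold dampedPot
    have h5 : 1 / 2 ≤ Real.exp (-(4 * (1 / 30) ^ 2 / n) * clampPot y) := by
      refine le_trans ?_ (Real.add_one_le_exp _)
      have h6 : clampPot y / n ≤ 1 := (div_le_one hnp).2 (clampPot_le y)
      have h7 : -(4 * (1 / 30) ^ 2 / (n : ℝ)) * clampPot y = -(1 / 225) * (clampPot y / n) := by
        ring
      rw [h7]; linarith
    have h8 : 0 ≤ ∑ i, Real.exp (1 / 30 * y i) := sum_nonneg fun _ _ => (Real.exp_pos _).le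
    nlinarith
  rw [div_le_iff₀ hnp]
  have : (2 + 60 / n * dampedPot (1 / 30) y) * n = n * 2 + 30 * (2 * dampedPot (1 / 30) y) := by
    field_simp; ring
  rw [this]
  linarith

lemma IsPacking.lintegral_dampedPot_le (h : P.IsPacking) (hn : 12 ≤ n) (t : ℕ) :
    ∫⁻ ω, ENNReal.ofReal (dampedPot (1 / 30) (normLoad (P.x t ω))) ∂P.μ
      ≤ ENNReal.ofReal (900 * n) := by
  have hn0 : 0 < n := by omega
  have hnR : (12 : ℝ) ≤ n := by exact_mod_cast hn
  have hnp : (0 : ℝ) < n := by linarith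
  induction t with
  | zero =>
    have hx : ∀ ω, P.x 0 ω = 0 := fun ω => funext fun i => P.x_zero ω i
    have h1 : dampedPot (1 / 30) (normLoad (0 : Fin n → ℕ)) ≤ 900 * n := by
      have e : normLoad (0 : Fin n → ℕ) = fun _ => 0 := by ext; simp [normLoad, avgLoad]
      rw [e]
      simp only [dampedPot, clampPot, unitClamp]
      simp
      linarith
    simp_rw [hx]
    rw [lintegral_const, measure_univ, mul_one]
    exact ENNReal.ofReal_le_ofReal h1
  | succ t ih =>
    simp_rw [h.2.normLoad_succ t]
    rw [h.1.lintegral_sel t fun x i =>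
      ENNReal.ofReal (dampedPot (1 / 30) (addBalls (normLoad x) i (packingInc x i)))]
    have hc : 0 ≤ 1 - 1 / (450 * (n : ℝ)) := by
      have : 1 / (450 * (n : ℝ)) ≤ 1 := (div_le_one (by positivity)).2 (by linarith)
      linarith
    calc _ ≤ ∫⁻ ω, (ENNReal.ofReal (1 - 1 / (450 * n)) *
          ENNReal.ofReal (dampedPot (1 / 30) (normLoad (P.x t ω))) + 2) ∂P.μ := by
          refine lintegral_mono fun ω => ?_
          rw [← ENNReal.ofReal_sum_of_nonneg fun _ _ => dampedPot_nonneg _ _,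
            ← ENNReal.ofReal_natCast n, ← ENNReal.ofReal_div_of_pos hnp]
          refine (ENNReal.ofReal_le_ofReal (packing_drift hn _)).trans ?_
          rw [ENNReal.ofReal_add (mul_nonneg hc (dampedPot_nonneg _ _)) (by norm_num),
            ENNReal.ofReal_mul hc]
          simp
      _ = ENNReal.ofReal (1 - 1 / (450 * n)) *
          (∫⁻ ω, ENNReal.ofReal (dampedPot (1 / 30) (normLoad (P.x t ω))) ∂P.μ) + 2 := by
          rw [lintegral_add_right _ measurable_const, lintegral_const_mul' _ _ (by simp)]
          simp
      _ ≤ ENNReal.ofReal (1 - 1 / (450 * n)) * ENNReal.ofReal (900 * n) + 2 := by gcongr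
      _ = ENNReal.ofReal ((1 - 1 / (450 * n)) * (900 * n) + 2) := by
          rw [ENNReal.ofReal_add (by positivity) (by norm_num), ENNReal.ofReal_mul hc]
          simp
      _ = ENNReal.ofReal (900 * n) := by
          congr 1
          field_simp
          ring

lemma IsPacking.lintegral_packingInc_le (h : P.IsPacking) (hn : 12 ≤ n) (t : ℕ) :
    ∫⁻ ω, (packingInc (P.x t ω) (P.sel t ω) : ℝ≥0∞) ∂P.μ ≤ 54002 := by
  have hn0 : 0 < n := by omega
  have hnp : (0 : ℝ) < n := by exact_mod_cast hn0
  rw [h.1.lintegral_sel t fun x i => (packingInc x i : ℝ≥0∞)]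
  calc _ ≤ ∫⁻ ω, (2 + ENNReal.ofReal (60 / n) *
          ENNReal.ofReal (dampedPot (1 / 30) (normLoad (P.x t ω)))) ∂P.μ := by
        refine lintegral_mono fun ω => ?_
        have e : (∑ i, (packingInc (P.x t ω) i : ℝ≥0∞)) / n =
            ENNReal.ofReal ((∑ i, (packingInc (P.x t ω) i : ℝ)) / n) := by
          rw [ENNReal.ofReal_div_of_pos hnp, ENNReal.ofReal_sum_of_nonneg fun _ _ => by positivity]
          simp
        rw [e]
        refine (ENNReal.ofReal_le_ofReal (packingInc_avg_le hn0 _)).trans ?_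
        rw [ENNReal.ofReal_add (by norm_num) (mul_nonneg (by positivity) (dampedPot_nonneg _ _)),
          ENNReal.ofReal_mul (by positivity)]
        simp
    _ = 2 + ENNReal.ofReal (60 / n) *
          ∫⁻ ω, ENNReal.ofReal (dampedPot (1 / 30) (normLoad (P.x t ω))) ∂P.μ := by
        rw [lintegral_add_left measurable_const, lintegral_const_mul' _ _ (by simp)]
        simp
    _ ≤ 2 + ENNReal.ofReal (60 / n) * ENNReal.ofReal (900 * n) := by
        gcongr; exact h.lintegral_dampedPot_le hn t
    _ = ENNReal.ofReal (2 + 60 / n * (900 * n)) := by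
        rw [ENNReal.ofReal_add (by norm_num) (by positivity),
          ENNReal.ofReal_mul (p := 60 / (n : ℝ)) (by positivity), ENNReal.ofReal_ofNat]
    _ = 54002 := by
        have : (2 + 60 / (n : ℝ) * (900 * n)) = 54002 := by field_simp; norm_num
        rw [this]; simp

lemma PackingRule.W_add (h : P.PackingRule) (t s : ℕ) (ω : P.Ω) :
    P.W (t + s) ω = P.W t ω +
      ∑ r ∈ range s, packingInc (P.x (t + r) ω) (P.sel (t + r) ω) := by
  induction s with
  | zero => simp
  | succ s ih => rw [← add_assoc, h.W_succ, ih, sum_range_succ, add_assoc]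

lemma measurable_sel (t : ℕ) : Measurable (P.sel t) := (P.meas_sel t).mono (P.F.le _) le_rfl

lemma measurable_packingInc (t : ℕ) :
    Measurable (fun ω => (packingInc (P.x t ω) (P.sel t ω) : ℝ≥0∞)) := by
  have h1 : Measurable (P.x t) := (measurable_x t).mono (P.F.le t) le_rfl
  have h2 : Measurable fun p : (Fin n → ℕ) × Fin n => (packingInc p.1 p.2 : ℝ≥0∞) :=
    Measurable.of_discrete
  have h3 : Measurable ((fun p : (Fin n → ℕ) × Fin n => (packingInc p.1 p.2 : ℝ≥0∞)) ∘
    fun ω => (P.x t ω, P.sel t ω)) := h2.comp (h1.prodMk (measurable_sel t))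
  exact h3

lemma measure_four_mul_le {Ω : Type*} [MeasurableSpace Ω] (μ : Measure Ω) {f : Ω → ℝ≥0∞}
    (hf : Measurable f) {c : ℝ≥0∞} (hc0 : c ≠ 0) (hc : c ≠ ∞) (h : ∫⁻ ω, f ω ∂μ ≤ c) :
    μ {ω | 4 * c ≤ f ω} ≤ 1 / 4 := by
  refine (meas_ge_le_lintegral_div hf.aemeasurable (by simp [hc0])
    (ENNReal.mul_ne_top (by simp) hc)).trans ?_
  refine (ENNReal.div_le_div_right h _).trans (le_of_eq ?_)
  rw [← ENNReal.mul_div_mul_right 1 4 hc0 hc, one_mul]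

/-- With probability at least `3 / 4`, the number of balls allocated in `s` rounds of `Packing`
is `O(s)`. -/
lemma IsPacking.measure_W_increase_le (h : P.IsPacking) (hn : 12 ≤ n) (t s : ℕ) (hs : 0 < s) :
    P.μ {ω | P.W t ω + 4 * (s * 54002) ≤ P.W (t + s) ω} ≤ 1 / 4 := by
  set f : P.Ω → ℝ≥0∞ := fun ω =>
    ∑ r ∈ range s, (packingInc (P.x (t + r) ω) (P.sel (t + r) ω) : ℝ≥0∞) with hf
  have h1 : ∫⁻ ω, f ω ∂P.μ ≤ s * 54002 := by
    rw [hf, lintegral_finsetSum _ fun r _ => measurable_packingInc (t + r)]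
    refine (sum_le_sum fun r _ => h.lintegral_packingInc_le hn (t + r)).trans ?_
    simp
  refine (measure_mono fun ω hω => ?_).trans (measure_four_mul_le P.μ
    (Finset.measurable_sum _ fun r _ => measurable_packingInc (t + r))
    (by simp [hs.ne']) (ENNReal.mul_ne_top (by simp) (by simp)) h1)
  rw [Set.mem_ofPred_eq, h.2.W_add t s ω] at hω
  have h2 := Nat.le_of_add_le_add_left hω
  have h3 : ((4 * (s * 54002) : ℕ) : ℝ≥0∞) ≤
      ((∑ r ∈ range s, packingInc (P.x (t + r) ω) (P.sel (t + r) ω) : ℕ) : ℝ≥0∞) :=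
    Nat.cast_le.2 h2
  push_cast at h3
  exact h3

/-- A lower bound on the load of a bin which is sampled in each of `k` consecutive blocks
of `ℓ` rounds. -/
lemma PackingRule.le_max_load (h : P.PackingRule) (t ℓ k : ℕ) (ω : P.Ω) (i : Fin n)
    (hit : ∀ j < k, ∃ r < ℓ, P.sel (t + ℓ * j + r) ω = i) :
    avgLoad (P.x t ω) + k ≤ max (P.x (t + ℓ * k) ω i : ℝ) (avgLoad (P.x t ω)) := by
  have mono_x : ∀ s, P.x s ω i ≤ P.x (s + 1) ω i := fun s => by
    rw [h.x_succ s ω i]; exact Nat.le_add_right _ _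
  have mono_x' : Monotone fun s => P.x s ω i := monotone_nat_of_le_succ mono_x
  have mono_avg : Monotone fun s => avgLoad (P.x s ω) :=
    monotone_nat_of_le_succ fun s => by
      apply div_le_div_of_nonneg_right _ (Nat.cast_nonneg n)
      have := h.W_succ s ω
      exact Nat.cast_le.2 (this.ge.trans' (Nat.le_add_right _ _))
  have hit_step : ∀ s, t ≤ s → P.sel s ω = i →
      max (P.x s ω i : ℝ) (avgLoad (P.x t ω)) + 1 ≤ P.x (s + 1) ω i := by
    intro s hs hsel
    have hx := h.x_succ s ω i
    rw [hsel, if_pos rfl] at hx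
    have hav := mono_avg hs
    simp only at hav
    rw [hx]
    push_cast
    rcases le_or_gt (avgLoad (P.x s ω)) (P.x s ω i) with h1 | h1
    · rw [packingInc_of_le h1, Nat.cast_one]
      have := max_le (le_refl (P.x s ω i : ℝ)) (hav.trans h1)
      linarith
    · have h2 := (packingInc_bounds h1).1
      have := max_le h1.le hav
      linarith
  induction k with
  | zero => simp
  | succ k ih =>
    have ih' := ih fun j hj => hit j (by omega)
    obtain ⟨r, hr, hsel⟩ := hit k (by omega)
    have h1 := hit_step (t + ℓ * k + r) (by omega) hsel
    have h2 : (P.x (t + ℓ * k) ω i : ℝ) ≤ P.x (t + ℓ * k + r) ω i :=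
      Nat.cast_le.2 (mono_x' (by omega))
    have h3 : (P.x (t + ℓ * k + r + 1) ω i : ℝ) ≤ P.x (t + ℓ * (k + 1)) ω i :=
      Nat.cast_le.2 (mono_x' (by rw [Nat.mul_succ]; omega))
    have h4 := max_le_max_right (avgLoad (P.x t ω)) h2
    have h5 := le_max_left (P.x (t + ℓ * (k + 1)) ω i : ℝ) (avgLoad (P.x t ω))
    push_cast
    linarith

/-- With high probability some bin is sampled in each of `k` consecutive blocks. -/
lemma UniformSampling.measure_no_bin_hit_le (h : P.UniformSampling) (hn : 2 ≤ n) (t ℓ k : ℕ)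
    (hp : 4 ≤ n * (1 - (1 - 1 / (n : ℝ)) ^ ℓ) ^ k) :
    P.μ {ω | ¬ ∃ i, ∀ j < k, ∃ r < ℓ, P.sel (t + ℓ * j + r) ω = i} ≤ 1 / 4 := by
  set e : (Fin (k * ℓ) → Fin n) ≃ (Fin k → Fin ℓ → Fin n) :=
    (Equiv.arrowCongr finProdFinEquiv.symm (Equiv.refl _)).trans (Equiv.curry _ _ _) with he
  set S : Finset (Fin k → Fin ℓ → Fin n) := univ.filter fun b => ∀ i, ∃ j, ∀ r, b j r ≠ i with hS
  have hsub : {ω | ¬ ∃ i, ∀ j < k, ∃ r < ℓ, P.sel (t + ℓ * j + r) ω = i} ⊆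
      {ω | (fun s : Fin (k * ℓ) => P.sel (t + s) ω) ∈ S.map e.symm.toEmbedding} := by
    intro ω hω
    simp only [Set.mem_ofPred_eq, mem_map_equiv, Equiv.symm_symm, hS, mem_filter, mem_univ,
      true_and]
    intro i
    by_contra hcon
    push Not at hcon
    refine hω ⟨i, fun j hj => ?_⟩
    obtain ⟨r, hr⟩ := hcon ⟨j, hj⟩
    refine ⟨r, r.2, ?_⟩
    rw [← hr]
    simp only [he, Equiv.trans_apply, Equiv.curry_apply, Function.curry, Equiv.arrowCongr_apply,
      Function.comp, Equiv.symm_symm, finProdFinEquiv_apply_val, Equiv.refl_apply]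
    congr 1
    omega
  refine (measure_mono hsub).trans ((h.measure_seq_mem_le t _ _).trans ?_)
  have h1 := card_no_bin_hit_in_every_block (ℓ := ℓ) (k := k) hn
  rw [← hS] at h1
  have h2 : (S.card : ℝ) * 4 ≤ n ^ (k * ℓ) :=
    (mul_le_mul_of_nonneg_left hp (Nat.cast_nonneg _)).trans h1
  have h3 : (S.card : ℝ≥0∞) * 4 ≤ (n : ℝ≥0∞) ^ (k * ℓ) := by exact_mod_cast h2
  have hn0 : ((n : ℝ≥0∞) ^ (k * ℓ)) ≠ 0 := pow_ne_zero _ (by simp; omega)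
  rw [card_map, ENNReal.div_le_iff hn0 (by simp), mul_comm, mul_one_div,
    ENNReal.le_div_iff_mul_le (by simp) (by simp)]
  exact h3

end Packing

end AllocProc

lemma four_le_mul_hit_prob_pow {n ℓ k : ℕ} (hn : (10 : ℝ) ^ 8 ≤ n)
    (hlog : 10 ^ 6 ≤ Real.log n) (hℓ : (n : ℝ) / (4 * 10 ^ 6) ≤ ℓ)
    (hk : (k : ℝ) ≤ 2 / 10 ^ 6 * Real.log n) :
    4 ≤ n * (1 - (1 - 1 / (n : ℝ)) ^ ℓ) ^ k := by
  have hnp : (0 : ℝ) < n := by linarith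
  have h1n : 1 / (n : ℝ) ≤ 1 := (div_le_one hnp).2 (by linarith)
  have h1 : (1 - 1 / (n : ℝ)) ^ ℓ ≤ Real.exp (-(1 / (4 * 10 ^ 6))) := by
    calc (1 - 1 / (n : ℝ)) ^ ℓ ≤ Real.exp (-(1 / n)) ^ ℓ :=
          pow_le_pow_left₀ (by linarith) (Real.one_sub_le_exp_neg _) _
      _ = Real.exp (-(ℓ / n)) := by rw [← Real.exp_nat_mul]; congr 1; ring
      _ ≤ _ := by
          apply Real.exp_le_exp.2
          have : 1 / (4 * 10 ^ 6) ≤ (ℓ : ℝ) / n := by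
            rw [le_div_iff₀ hnp]; linarith
          linarith
  have h2 : Real.exp (-(1 / (4 * 10 ^ 6))) ≤ 1 - 1 / (8 * 10 ^ 6) :=
    (exp_le_one_add_add_sq (by norm_num)).trans (by norm_num)
  have h3 : Real.exp (-23) ≤ 1 / (8 * 10 ^ 6) := by
    have h4 : (2 : ℝ) ^ 23 ≤ Real.exp 23 := by
      calc (2 : ℝ) ^ 23 ≤ Real.exp 1 ^ 23 :=
            pow_le_pow_left₀ (by norm_num) (by linarith [Real.add_one_le_exp (1 : ℝ)]) _
        _ = Real.exp 23 := by rw [← Real.exp_nat_mul]; norm_num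
    rw [Real.exp_neg, ← one_div]
    exact one_div_le_one_div_of_le (by norm_num) (le_trans (by norm_num) h4)
  calc (4 : ℝ) ≤ Real.log n / 2 + 1 := by linarith
    _ ≤ Real.exp (Real.log n / 2) := Real.add_one_le_exp _
    _ ≤ Real.exp (Real.log n + k * (-23)) := Real.exp_le_exp.2 (by linarith)
    _ = n * Real.exp (-23) ^ k := by
        rw [Real.exp_add, Real.exp_log hnp, Real.exp_nat_mul]
    _ ≤ n * (1 - (1 - 1 / (n : ℝ)) ^ ℓ) ^ k := by
        apply mul_le_mul_of_nonneg_left _ hnp.le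
        exact pow_le_pow_left₀ (Real.exp_pos _).le (by linarith) _

/-- **Theorem (lower bound for Packing).** There exists a constant `κ > 0` such that, for all
sufficiently large `n` and any number of rounds `m ≥ κ n log n`, the `Packing` process
satisfies `Gap(m) ≥ (√κ/20) log n` with probability at least `1/2`. -/
theorem packing_gap_lower_bound :
    ∃ κ : ℝ, 0 < κ ∧ ∃ N : ℕ, ∀ n : ℕ, N ≤ n →
      ∀ m : ℕ, κ * n * Real.log n ≤ m →
        ∀ P : AllocProc n, P.IsPacking →
          P.μ {ω | Real.sqrt κ / 20 * Real.log n ≤ P.Gap m ω} ≥ 1 / 2 := by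
  refine ⟨(1 / 10 ^ 6) ^ 2, by norm_num, ?_⟩
  have hev : ∀ᶠ n : ℕ in Filter.atTop, (10 : ℝ) ^ 8 ≤ n ∧ 10 ^ 6 ≤ Real.log n :=
    (tendsto_natCast_atTop_atTop.eventually_ge_atTop _).and
      ((Real.tendsto_log_atTop.comp tendsto_natCast_atTop_atTop).eventually_ge_atTop _)
  obtain ⟨N, hN⟩ := Filter.eventually_atTop.1 hev
  refine ⟨N, fun n hn m hm P hP => ?_⟩
  obtain ⟨hnR, hlog⟩ := hN n hn
  rw [Real.sqrt_sq (by norm_num)]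
  have hnp : (0 : ℝ) < n := by linarith
  have hn12 : 12 ≤ n := by
    have : (12 : ℝ) ≤ n := by linarith
    exact_mod_cast this
  set k := ⌈1 / 10 ^ 6 * Real.log n⌉₊ with hk
  set ℓ := ⌊(n : ℝ) / (2 * 10 ^ 6)⌋₊ with hℓ
  have hk1 : 1 / 10 ^ 6 * Real.log n ≤ k := Nat.le_ceil _
  have hk2 : (k : ℝ) ≤ 2 / 10 ^ 6 * Real.log n := by
    have : (k : ℝ) < 1 / 10 ^ 6 * Real.log n + 1 :=
      Nat.ceil_lt_add_one (by linarith : 0 ≤ 1 / 10 ^ 6 * Real.log n)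
    linarith
  have hℓ1 : (ℓ : ℝ) ≤ n / (2 * 10 ^ 6) := Nat.floor_le (by positivity)
  have hℓ2 : (n : ℝ) / (4 * 10 ^ 6) ≤ ℓ := by
    have : (n : ℝ) / (2 * 10 ^ 6) < (ℓ : ℝ) + 1 := Nat.lt_floor_add_one ((n : ℝ) / (2 * 10 ^ 6))
    linarith
  have hk0 : 0 < k := Nat.cast_pos.1 (by linarith : (0 : ℝ) < k)
  have hℓ0 : 0 < ℓ := Nat.cast_pos.1 (by linarith : (0 : ℝ) < ℓ)
  have hkℓ : ℓ * k ≤ m := by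
    have h1 : (ℓ : ℝ) * k ≤ n / (2 * 10 ^ 6) * (2 / 10 ^ 6 * Real.log n) :=
      mul_le_mul hℓ1 hk2 (Nat.cast_nonneg _) (by positivity)
    have h2 : ((ℓ * k : ℕ) : ℝ) ≤ m := by push_cast; linarith
    exact_mod_cast h2
  obtain ⟨t, rfl⟩ := Nat.exists_eq_add_of_le' hkℓ
  have hA := hP.measure_W_increase_le hn12 t (ℓ * k) (Nat.mul_pos hℓ0 hk0)
  have hB := hP.1.measure_no_bin_hit_le (by omega) t ℓ k
    (four_le_mul_hit_prob_pow hnR hlog hℓ2 hk2)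
  set A := {ω | P.W t ω + 4 * (ℓ * k * 54002) ≤ P.W (t + ℓ * k) ω}
  set B := {ω | ¬ ∃ i, ∀ j < k, ∃ r < ℓ, P.sel (t + ℓ * j + r) ω = i}
  set C := {ω | 1 / 10 ^ 6 / 20 * Real.log n ≤ P.Gap (t + ℓ * k) ω}
  have hcover : Set.univ ⊆ C ∪ (A ∪ B) := by
    intro ω _
    by_contra hω
    simp only [Set.mem_union, not_or] at hω
    obtain ⟨hC, hA, hB⟩ := hω
    obtain ⟨i, hi⟩ := not_not.1 hB
    have hW : (P.W (t + ℓ * k) ω : ℝ) ≤ P.W t ω + 4 * (ℓ * k * 54002) := by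
      exact_mod_cast (not_le.1 hA).le
    have hmax := hP.2.le_max_load t ℓ k ω i hi
    have hkR : (0 : ℝ) < k := by exact_mod_cast hk0
    have hx : (P.W t ω : ℝ) / n + k ≤ P.x (t + ℓ * k) ω i := by
      rcases le_max_iff.1 hmax with h | h
      · exact h
      · linarith
    have hsup : (P.x (t + ℓ * k) ω i : ℝ) ≤ ⨆ i, (P.x (t + ℓ * k) ω i : ℝ) :=
      le_ciSup (f := fun i => (P.x (t + ℓ * k) ω i : ℝ)) (Set.finite_range _).bddAbove i
    have hWn : (P.W (t + ℓ * k) ω : ℝ) / n ≤ P.W t ω / n + 4 * 54002 / (2 * 10 ^ 6) * k := by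
      rw [div_le_iff₀ hnp, add_mul, div_mul_cancel₀ _ hnp.ne']
      have := mul_le_mul_of_nonneg_right hℓ1 hkR.le
      linarith
    refine hC ?_
    change _ ≤ (⨆ i, (P.x (t + ℓ * k) ω i : ℝ)) - (P.W (t + ℓ * k) ω : ℝ) / n
    linarith
  have h1 : (1 : ℝ≥0∞) ≤ P.μ C + 1 / 2 := by
    calc (1 : ℝ≥0∞) = P.μ Set.univ := measure_univ.symm
      _ ≤ P.μ C + (P.μ A + P.μ B) := (measure_mono hcover).trans
          ((measure_union_le _ _).trans (add_le_add_right (measure_union_le _ _) _))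
      _ ≤ P.μ C + (1 / 4 + 1 / 4) := by gcongr
      _ = P.μ C + 1 / 2 := by
          congr 1
          rw [← ENNReal.add_div]
          exact (ENNReal.div_eq_div_iff (by simp) (by simp) (by simp) (by simp)).2 (by norm_num)
  have h2 : (1 : ℝ≥0∞) / 2 + 1 / 2 ≤ P.μ C + 1 / 2 := by
    rwa [ENNReal.add_halves]
  exact (ENNReal.add_le_add_iff_right (by simp)).1 h2
end
end

section
/- Consider the Packing process on n bins with any (a,b)-biased probability vector, where a := a(n) > 1 and b := b(n) > 1. Then for any round m ≥ 1, E[Δ^m] ≤ 6·a·n^3, and consequently the probability that Gap(m) ≤ 6·a·n^4 is at least 1 − n^{−1}. -/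
open MeasureTheory ProbabilityTheory Real Finset
open scoped ENNReal Classical

noncomputable section

/-- A family summing to zero has equal sums of positive and negative parts. -/
theorem sum_posPart_eq_sum_negPart {ι : Type*} [Fintype ι] {u : ι → ℝ}
    (hsum : ∑ j, u j = 0) : ∑ j, max (u j) 0 = ∑ j, max (-u j) 0 := by
  have h : ∀ j, max (u j) 0 = u j + max (-u j) 0 := fun j => by
    rcases le_total 0 (u j) with h | h
    · rw [max_eq_left h, max_eq_right (by linarith)]; ring
    · rw [max_eq_right h, max_eq_left (by linarith)]; ring
  rw [Finset.sum_congr rfl fun j _ => h j, Finset.sum_add_distrib, hsum, zero_add]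

/-- If `u` sums to zero and `v` arises from `u` by lowering every coordinate other than `i`
by at least `u i⁻ / N` and raising `u i⁺` by at most `2`, then the sum of positive parts grows
by at most `2 - u i⁻ / N`. -/
theorem sum_posPart_le_of_fill {ι : Type*} [Fintype ι] {u v : ι → ℝ} {i : ι}
    (hsum : ∑ j, u j = 0)
    (hne : ∀ j, j ≠ i → v j ≤ u j - max (-u i) 0 / Fintype.card ι)
    (hi : v i ≤ max (u i) 0 + 2) :
    ∑ j, max (v j) 0 ≤ ∑ j, max (u j) 0 + 2 - max (-u i) 0 / Fintype.card ι := by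
  have hN : (0 : ℝ) < Fintype.card ι := by
    exact_mod_cast Fintype.card_pos_iff.mpr ⟨i⟩
  have hneg := sum_posPart_eq_sum_negPart hsum
  set c := max (-u i) 0 with hc
  have hc0 : 0 ≤ c := le_max_right _ _
  have hd0 : 0 ≤ c / Fintype.card ι := by positivity
  obtain ⟨k, hk⟩ : ∃ k, c / Fintype.card ι ≤ max (u k) 0 := by
    by_contra! h
    have h1 : ∑ j, max (u j) 0 < ∑ _j : ι, c / Fintype.card ι :=
      Finset.sum_lt_sum_of_nonempty ⟨i, mem_univ i⟩ fun j _ => h j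
    have h2 : c ≤ ∑ j, max (-u j) 0 :=
      Finset.single_le_sum (f := fun j => max (-u j) 0) (fun j _ => le_max_right _ _) (mem_univ i)
    rw [Finset.sum_const, card_univ, nsmul_eq_mul, mul_div_cancel₀ _ hN.ne'] at h1
    linarith
  have hterm : ∀ j, max (v j) 0 ≤ max (u j) 0 + (if j = i then 2 else 0)
      - (if j = k then c / Fintype.card ι else 0) := by
    intro j
    rcases eq_or_ne j i with rfl | hji
    · have hz : (if j = k then c / (Fintype.card ι : ℝ) else 0) ≤ 0 := by
        split_ifs with hjk
        · subst hjk
          rcases le_total 0 (u j) with h | h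
          · simp [hc, h]
          · rwa [max_eq_right h] at hk
        · exact le_rfl
      have h0 : 0 ≤ max (u j) 0 := le_max_right _ _
      simp only [if_true]
      exact max_le (by linarith) (by linarith)
    · have hv := hne j hji
      have h0 : 0 ≤ max (u j) 0 := le_max_right _ _
      have h1 : u j ≤ max (u j) 0 := le_max_left _ _
      rw [if_neg hji, add_zero]
      split_ifs with hjk
      · subst hjk
        exact max_le (by linarith) (by linarith)
      · exact max_le (by linarith) (by linarith)
  refine (Finset.sum_le_sum fun j _ => hterm j).trans_eq ?_
  simp [Finset.sum_add_distrib, Finset.sum_sub_distrib]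

/-- Lower bound for the expected value of an `m`-measurable weight on an event whose
conditional probability given `m` is at least `p`. -/
theorem mul_integral_le_integral_mul_indicator {Ω : Type*} {m m0 : MeasurableSpace Ω}
    {μ : Measure Ω} [IsFiniteMeasure μ] (hm : m ≤ m0) {g : Ω → ℝ} {s : Set Ω} {p c : ℝ}
    (hs : MeasurableSet s) (hg : StronglyMeasurable[m] g) (hg0 : ∀ ω, 0 ≤ g ω)
    (hgc : ∀ ω, g ω ≤ c)
    (hp : ∀ᵐ ω ∂μ, p ≤ (μ[s.indicator (fun _ => (1 : ℝ)) | m]) ω) :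
    p * ∫ ω, g ω ∂μ ≤ ∫ ω, g ω * s.indicator (fun _ => (1 : ℝ)) ω ∂μ := by
  have hind : Integrable (s.indicator fun _ => (1 : ℝ)) μ :=
    (integrable_const 1).indicator hs
  have hbd : ∀ᵐ ω ∂μ, ‖g ω‖ ≤ c := .of_forall fun ω => by
    rw [Real.norm_of_nonneg (hg0 ω)]; exact hgc ω
  have hgm : AEStronglyMeasurable g μ := (hg.mono hm).aestronglyMeasurable
  have hgi : Integrable g μ := .of_bound hgm c hbd
  have hpull := condExp_stronglyMeasurable_mul_of_bound hm hg hind c hbd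
  have heq : ∫ ω, g ω * s.indicator (fun _ => (1 : ℝ)) ω ∂μ
      = ∫ ω, g ω * (μ[s.indicator (fun _ => (1 : ℝ)) | m]) ω ∂μ :=
    (integral_condExp hm).symm.trans (integral_congr_ae hpull)
  rw [heq, ← integral_const_mul]
  refine integral_mono_ae (hgi.const_mul p) (integrable_condExp.bdd_mul hgm hbd) ?_
  filter_upwards [hp] with ω hω
  rw [mul_comm]
  exact mul_le_mul_of_nonneg_left hω (hg0 ω)

namespace AllocProc

variable {n : ℕ} (P : AllocProc n)

/-- Total normalized load above the average. -/
def excess (t : ℕ) (ω : P.Ω) : ℝ := ∑ i, max (P.y t ω i) 0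

theorem excess_nonneg (t : ℕ) (ω : P.Ω) : 0 ≤ P.excess t ω :=
  Finset.sum_nonneg fun _ _ => le_max_right _ _

theorem sum_y (hn : 0 < n) (t : ℕ) (ω : P.Ω) : ∑ i, P.y t ω i = 0 := by
  have : (n : ℝ) ≠ 0 := by positivity
  simp only [y, W, Finset.sum_sub_distrib, Finset.sum_const, card_univ, Fintype.card_fin,
    nsmul_eq_mul, Nat.cast_sum]
  field_simp
  ring

theorem excess_eq_sum_neg (hn : 0 < n) (t : ℕ) (ω : P.Ω) :
    P.excess t ω = ∑ i, max (-P.y t ω i) 0 :=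
  sum_posPart_eq_sum_negPart (P.sum_y hn t ω)

theorem Δpot_eq_two_mul_excess (hn : 0 < n) (t : ℕ) (ω : P.Ω) :
    P.Δpot t ω = 2 * P.excess t ω := by
  have h : ∀ i, |P.y t ω i| = max (P.y t ω i) 0 + max (-P.y t ω i) 0 := fun i => by
    rcases le_total 0 (P.y t ω i) with h | h
    · rw [abs_of_nonneg h, max_eq_left h, max_eq_right (by linarith)]; ring
    · rw [abs_of_nonpos h, max_eq_right h, max_eq_left (by linarith)]; ring
  rw [Δpot, Finset.sum_congr rfl fun i _ => h i, Finset.sum_add_distrib,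
    ← P.excess_eq_sum_neg hn, ← excess]
  ring

theorem Gap_le_Δpot (hn : 0 < n) (t : ℕ) (ω : P.Ω) : P.Gap t ω ≤ P.Δpot t ω := by
  have : Nonempty (Fin n) := ⟨⟨0, hn⟩⟩
  rw [Gap, sub_le_iff_le_add]
  refine ciSup_le fun i => ?_
  have h1 : |P.y t ω i| ≤ P.Δpot t ω :=
    Finset.single_le_sum (f := fun j => |P.y t ω j|) (fun _ _ => abs_nonneg _) (mem_univ i)
  have h2 := le_abs_self (P.y t ω i)
  have h3 : P.y t ω i = (P.x t ω i : ℝ) - (P.W t ω : ℝ) / n := rfl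
  linarith

theorem measurable_y (t : ℕ) (i : Fin n) : Measurable[P.F t] fun ω => P.y t ω i := by
  have hx : ∀ j, Measurable[P.F t] fun ω => (P.x t ω j : ℝ) := fun j =>
    (measurable_of_countable (fun k : ℕ => (k : ℝ))).comp (P.meas_x t j)
  simp only [y, W, Nat.cast_sum]
  exact (hx i).sub ((Finset.measurable_fun_sum _ fun j _ => hx j).div_const _)

theorem measurable_excess (t : ℕ) : Measurable[P.F t] (P.excess t) :=
  Finset.measurable_fun_sum _ fun i _ => (P.measurable_y t i).max measurable_const

variable {P}

theorem PackingRule.excess_succ_le (hrule : P.PackingRule) (t : ℕ) (ω : P.Ω) :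
    P.excess (t + 1) ω ≤ P.excess t ω + 2 - max (-P.y t ω (P.sel t ω)) 0 / n := by
  set s := P.sel t ω with hs
  have hn : 0 < n := s.pos
  have hnR : (0 : ℝ) < n := by positivity
  have hx : ∀ j, j ≠ s → P.x (t + 1) ω j = P.x t ω j := fun j hj => by
    rw [hrule t ω j, if_neg hj]
  have hxs := hrule t ω s
  rw [if_pos hs] at hxs
  have hW : (P.W (t + 1) ω : ℝ) - P.W t ω = (P.x (t + 1) ω s : ℝ) - P.x t ω s := by
    simp only [W, Nat.cast_sum]
    rw [← Finset.sum_sub_distrib]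
    refine Finset.sum_eq_single s (fun j _ hj => by rw [hx j hj, sub_self]) (by simp)
  have hys : P.y t ω s = (P.x t ω s : ℝ) - (P.W t ω : ℝ) / n := rfl
  have hfill : max (-P.y t ω s) 0 ≤ (P.W (t + 1) ω : ℝ) - P.W t ω ∧
      (P.x (t + 1) ω s : ℝ) ≤ (P.W t ω : ℝ) / n + max (P.y t ω s) 0 + 2 := by
    rw [hW, hxs]
    split_ifs with h
    · push_cast
      rw [max_eq_right (by linarith), max_eq_left (by linarith)]
      constructor <;> linarith
    · push_cast
      rw [max_eq_left (by linarith), max_eq_right (by linarith)]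
      have h1 := Nat.le_ceil ((P.W t ω : ℝ) / n)
      have h2 := Nat.ceil_lt_add_one (a := (P.W t ω : ℝ) / n) (by positivity)
      constructor <;> linarith
  have hdiv : max (-P.y t ω s) 0 / n ≤ (P.W (t + 1) ω : ℝ) / n - (P.W t ω : ℝ) / n := by
    rw [← sub_div]
    gcongr
    exact hfill.1
  have h0 : 0 ≤ max (-P.y t ω s) 0 / n := div_nonneg (le_max_right _ _) hnR.le
  have key := sum_posPart_le_of_fill (u := P.y t ω) (v := P.y (t + 1) ω) (i := s)
    (P.sum_y hn t ω)
  rw [Fintype.card_fin] at key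
  refine key (fun j hj => ?_) ?_
  · simp only [y] at hdiv ⊢
    rw [hx j hj]
    linarith
  · have := hfill.2
    have hy' : P.y (t + 1) ω s = (P.x (t + 1) ω s : ℝ) - (P.W (t + 1) ω : ℝ) / n := rfl
    linarith

theorem PackingRule.excess_le (hrule : P.PackingRule) (t : ℕ) (ω : P.Ω) :
    P.excess t ω ≤ 2 * t := by
  induction t with
  | zero => simp [excess, y, W, P.x_zero]
  | succ t ih =>
    have h := hrule.excess_succ_le t ω
    have h0 : 0 ≤ max (-P.y t ω (P.sel t ω)) 0 / (n : ℝ) :=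
      div_nonneg (le_max_right _ _) n.cast_nonneg
    push_cast
    linarith

theorem PackingRule.integrable_excess (hrule : P.PackingRule) (t : ℕ) :
    letI := P.m0
    Integrable (P.excess t) P.μ := by
  let := P.m0
  have := P.prob
  refine .of_bound ((P.measurable_excess t).mono (P.F.le t) le_rfl).aestronglyMeasurable
    (2 * t) (.of_forall fun ω => ?_)
  rw [Real.norm_of_nonneg (P.excess_nonneg t ω)]
  exact hrule.excess_le t ω

/-- One-round drift of the expected excess. -/
theorem PackingRule.integral_excess_succ_le (hrule : P.PackingRule) (hn : 0 < n) {a b : ℝ}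
    (hbias : P.BiasedSampling a b) (t : ℕ) :
    ∫ ω, P.excess (t + 1) ω ∂P.μ ≤
      ∫ ω, P.excess t ω ∂P.μ + 2 - 1 / (a * n) * (∫ ω, P.excess t ω ∂P.μ) / n := by
  let := P.m0
  have := P.prob
  set g : Fin n → P.Ω → ℝ := fun i ω => max (-P.y t ω i) 0 with hg
  set S : Fin n → Set P.Ω := fun i => {ω | P.sel t ω = i} with hS
  have hSm : ∀ i, MeasurableSet (S i) := fun i =>
    P.F.le (t + 1) _ (P.meas_sel t (measurableSet_singleton i))
  have hgm : ∀ i, Measurable[P.F t] (g i) := fun i =>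
    (P.measurable_y t i).neg.max measurable_const
  have hg0 : ∀ i ω, 0 ≤ g i ω := fun i ω => le_max_right _ _
  have hgc : ∀ i ω, g i ω ≤ 2 * t := fun i ω => by
    refine le_trans ?_ (hrule.excess_le t ω)
    rw [P.excess_eq_sum_neg hn]
    exact Finset.single_le_sum (f := fun j => g j ω) (fun j _ => hg0 j ω) (mem_univ i)
  have hgi : ∀ i, Integrable (g i) P.μ := fun i =>
    .of_bound ((hgm i).mono (P.F.le t) le_rfl).aestronglyMeasurable (2 * t)
      (.of_forall fun ω => by rw [Real.norm_of_nonneg (hg0 i ω)]; exact hgc i ω)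
  have hgS : ∀ i, Integrable (fun ω => g i ω * (S i).indicator (fun _ => (1 : ℝ)) ω) P.μ := by
    intro i
    refine ((hgi i).indicator (hSm i)).congr (.of_forall fun ω => ?_)
    by_cases h : ω ∈ S i <;> simp [h]
  have hdrift : 1 / (a * n) * ∫ ω, P.excess t ω ∂P.μ ≤
      ∫ ω, ∑ i, g i ω * (S i).indicator (fun _ => (1 : ℝ)) ω ∂P.μ := by
    rw [integral_finsetSum _ fun i _ => hgS i]
    simp only [P.excess_eq_sum_neg hn t]
    rw [integral_finsetSum _ fun i _ => hgi i, Finset.mul_sum]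
    exact Finset.sum_le_sum fun i _ =>
      mul_integral_le_integral_mul_indicator (P.F.le t) (hSm i) (hgm i).stronglyMeasurable
        (hg0 i) (hgc i) ((hbias t i).mono fun ω h => h.1)
  have hpt : ∀ ω, P.excess (t + 1) ω ≤ P.excess t ω + 2 -
      (∑ i, g i ω * (S i).indicator (fun _ => (1 : ℝ)) ω) / n := fun ω => by
    have : ∑ i, g i ω * (S i).indicator (fun _ => (1 : ℝ)) ω = g (P.sel t ω) ω := by
      simp [hS, Set.indicator_apply]
    rw [this]
    exact hrule.excess_succ_le t ω
  have hsumi : Integrable (fun ω => ∑ i, g i ω * (S i).indicator (fun _ => (1 : ℝ)) ω) P.μ :=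
    integrable_finsetSum _ fun i _ => hgS i
  have hei := hrule.integrable_excess t
  have hint : Integrable (fun ω => P.excess t ω + 2) P.μ := hei.add (integrable_const 2)
  calc ∫ ω, P.excess (t + 1) ω ∂P.μ
      ≤ ∫ ω, (P.excess t ω + 2 -
          (∑ i, g i ω * (S i).indicator (fun _ => (1 : ℝ)) ω) / n) ∂P.μ :=
        integral_mono (hrule.integrable_excess (t + 1)) (hint.sub (hsumi.div_const _)) hpt
    _ = ∫ ω, P.excess t ω ∂P.μ + 2 -
          (∫ ω, ∑ i, g i ω * (S i).indicator (fun _ => (1 : ℝ)) ω ∂P.μ) / n := by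
        rw [integral_sub hint (hsumi.div_const _), integral_add hei (integrable_const 2),
          integral_div]
        simp
    _ ≤ _ := by gcongr

theorem PackingRule.integral_excess_le (hrule : P.PackingRule) (hn : 0 < n) {a b : ℝ}
    (ha : 1 < a) (hbias : P.BiasedSampling a b) (t : ℕ) :
    ∫ ω, P.excess t ω ∂P.μ ≤ 2 * a * (n : ℝ) ^ 2 := by
  have hn1 : (1 : ℝ) ≤ n := by exact_mod_cast hn
  have hq : 1 ≤ a * (n : ℝ) ^ 2 := by nlinarith
  induction t with
  | zero =>
    have : ∀ ω, P.excess 0 ω = 0 := fun ω => by simp [excess, y, W, P.x_zero]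
    simp only [this, integral_zero]
    positivity
  | succ t ih =>
    refine (hrule.integral_excess_succ_le hn hbias t).trans ?_
    set E := ∫ ω, P.excess t ω ∂P.μ
    have hrw : E + 2 - 1 / (a * n) * E / n =
        E * (1 - 1 / (a * (n : ℝ) ^ 2)) + 2 := by
      field_simp
      ring
    have hle : 0 ≤ 1 - 1 / (a * (n : ℝ) ^ 2) := by
      rw [sub_nonneg, div_le_one (by linarith)]
      exact hq
    calc E + 2 - 1 / (a * n) * E / n
        = E * (1 - 1 / (a * (n : ℝ) ^ 2)) + 2 := hrw
      _ ≤ 2 * a * (n : ℝ) ^ 2 * (1 - 1 / (a * (n : ℝ) ^ 2)) + 2 := by gcongr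
      _ = 2 * a * (n : ℝ) ^ 2 := by
        field_simp
        ring

end AllocProc

/-- **Proposition (Packing with a biased probability vector).** For the `Packing` process with
any `(a,b)`-biased probability vector (`a = a(n) > 1`, `b = b(n) > 1`), for any round `m ≥ 1`
we have `E[Δ^m] ≤ 6 a n³`, and hence `Gap(m) ≤ 6 a n⁴` with probability at least `1 - n⁻¹`. -/
theorem packing_biased_gap (n : ℕ) (hn : 0 < n) (a b : ℝ) (ha : 1 < a) (hb : 1 < b)
    (P : AllocProc n) (hrule : P.PackingRule) (hbias : P.BiasedSampling a b) :
    ∀ m : ℕ, 1 ≤ m →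
      (∫ ω, P.Δpot m ω ∂P.μ ≤ 6 * a * (n : ℝ) ^ 3) ∧
      P.μ {ω | P.Gap m ω ≤ 6 * a * (n : ℝ) ^ 4} ≥ 1 - (n : ℝ≥0∞)⁻¹ := by
  intro m _
  let := P.m0
  have := P.prob
  have hn1 : (1 : ℝ) ≤ n := by exact_mod_cast hn
  have hΔ : P.Δpot m = fun ω => 2 * P.excess m ω := funext (P.Δpot_eq_two_mul_excess hn m)
  have hΔi : Integrable (P.Δpot m) P.μ := hΔ ▸ (hrule.integrable_excess m).const_mul 2
  have hE : ∫ ω, P.Δpot m ω ∂P.μ ≤ 6 * a * (n : ℝ) ^ 3 := by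
    rw [hΔ, integral_const_mul]
    have h1 := hrule.integral_excess_le hn ha hbias m
    have h2 : (n : ℝ) ^ 2 ≤ (n : ℝ) ^ 3 := pow_le_pow_right₀ hn1 (by norm_num)
    have h3 : a * (n : ℝ) ^ 2 ≤ a * (n : ℝ) ^ 3 := by gcongr
    have h4 : 0 ≤ a * (n : ℝ) ^ 2 := by positivity
    linarith
  refine ⟨hE, ?_⟩
  set c := 6 * a * (n : ℝ) ^ 4 with hc
  have hc0 : 0 < c := by positivity
  have hmarkov := mul_meas_ge_le_integral_of_nonneg
    (.of_forall fun ω => Finset.sum_nonneg fun i _ => abs_nonneg (P.y m ω i)) hΔi c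
  have hreal : P.μ.real {ω | c ≤ P.Δpot m ω} ≤ (n : ℝ)⁻¹ := by
    have h : c * P.μ.real {ω | c ≤ P.Δpot m ω} ≤ c * (n : ℝ)⁻¹ := by
      refine (hmarkov.trans hE).trans_eq ?_
      rw [hc]
      field_simp
    exact le_of_mul_le_mul_left h hc0
  have hbad : P.μ {ω | c ≤ P.Δpot m ω} ≤ (n : ℝ≥0∞)⁻¹ := by
    rw [← ofReal_measureReal]
    refine (ENNReal.ofReal_le_ofReal hreal).trans_eq ?_
    rw [ENNReal.ofReal_inv_of_pos (by positivity), ENNReal.ofReal_natCast]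
  have hcover : (Set.univ : Set P.Ω) ⊆ {ω | P.Gap m ω ≤ c} ∪ {ω | c ≤ P.Δpot m ω} := by
    intro ω _
    rcases le_total (P.Δpot m ω) c with h | h
    · exact Or.inl ((P.Gap_le_Δpot hn m ω).trans h)
    · exact Or.inr h
  refine tsub_le_iff_right.mpr ?_
  calc (1 : ℝ≥0∞) = P.μ Set.univ := measure_univ.symm
    _ ≤ P.μ {ω | P.Gap m ω ≤ c} + P.μ {ω | c ≤ P.Δpot m ω} :=
      (measure_mono hcover).trans (measure_union_le _ _)
    _ ≤ _ := by gcongr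
end
end

section
/- For any allocation process on n bins that samples a bin uniformly at random in each round and satisfies condition W, the probability that Gap(n/2) ≥ (1/2)·(log n)/(log log n) is at least 1 − o(1) as n → ∞. -/
open MeasureTheory ProbabilityTheory Real Finset
open scoped ENNReal Classical

noncomputable section

section Occupancy

theorem Finset.card_mul_le_of_forall_notMem {Ω ι : Type*} [Fintype Ω] [DecidableEq Ω]
    (S : Finset ι)
    (A : ι → Finset Ω) {a : ℝ} (hA : ∀ i ∈ S, (#(A i) : ℝ) = a)
    (hpair : ∀ i ∈ S, ∀ j ∈ S, i ≠ j → (#(A i ∩ A j) : ℝ) * Fintype.card Ω ≤ a ^ 2)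
    {Z : Finset Ω} (hZ : ∀ ω ∈ Z, ∀ i ∈ S, ω ∉ A i) :
    (#Z : ℝ) * (#S * a) ≤ (Fintype.card Ω : ℝ) ^ 2 := by
  set N : ℝ := (Fintype.card Ω : ℝ) with hN
  set s : ℝ := (#S : ℝ) with hs
  have hN0 : 0 ≤ N := by positivity
  let X : Ω → ℝ := fun ω => ∑ i ∈ S, if ω ∈ A i then 1 else 0
  have hX1 : ∑ ω, X ω = s * a := by
    simp only [X]
    rw [Finset.sum_comm]
    rw [Finset.sum_congr rfl (g := fun _ => a)]
    · simp [hs]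
    · intro i hi
      simp [← hA i hi]
  have hX2 : ∑ ω, X ω ^ 2 = ∑ i ∈ S, ∑ j ∈ S, (#(A i ∩ A j) : ℝ) := by
    simp only [X, sq, Finset.sum_mul_sum]
    rw [Finset.sum_comm]
    refine Finset.sum_congr rfl fun i _ => ?_
    rw [Finset.sum_comm]
    refine Finset.sum_congr rfl fun j _ => ?_
    simp only [← ite_and, mul_ite, mul_one, mul_zero]
    rw [Finset.sum_boole]
    congr 2
    ext ω
    simp [and_comm]
  have hX2' : N * ∑ ω, X ω ^ 2 ≤ N * (s * a) + s ^ 2 * a ^ 2 := by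
    rw [hX2, Finset.mul_sum]
    have : ∀ i ∈ S, N * ∑ j ∈ S, (#(A i ∩ A j) : ℝ) ≤ N * a + s * a ^ 2 := by
      intro i hi
      have h1 : ∀ j ∈ S, N * (#(A i ∩ A j) : ℝ) ≤ (if j = i then N * a else 0) + a ^ 2 := by
        intro j hj
        split_ifs with hij
        · subst hij
          rw [Finset.inter_self, hA j hj]
          nlinarith [sq_nonneg a]
        · rw [zero_add, mul_comm]
          exact hpair i hi j hj (Ne.symm hij)
      rw [Finset.mul_sum]
      refine (Finset.sum_le_sum h1).trans ?_
      rw [Finset.sum_add_distrib, Finset.sum_ite_eq' S i]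
      simp [hi, hs]
    refine (Finset.sum_le_sum this).trans ?_
    rw [Finset.sum_const, nsmul_eq_mul, ← hs]
    nlinarith
  have hvar : ∑ ω, (N * X ω - s * a) ^ 2 ≤ N ^ 2 * (s * a) := by
    have : ∑ ω, (N * X ω - s * a) ^ 2
        = N * (N * ∑ ω, X ω ^ 2) - 2 * N * (s * a) * ∑ ω, X ω + N * (s * a) ^ 2 := by
      have h : ∀ ω, (N * X ω - s * a) ^ 2
          = N * (N * X ω ^ 2) - 2 * N * (s * a) * X ω + (s * a) ^ 2 := fun ω => by ring
      simp only [h, Finset.sum_add_distrib, Finset.sum_sub_distrib, ← Finset.mul_sum]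
      simp [hN]
    rw [this, hX1]
    nlinarith [mul_le_mul_of_nonneg_left hX2' hN0]
  have hZX : (#Z : ℝ) * (s * a) ^ 2 ≤ ∑ ω, (N * X ω - s * a) ^ 2 := by
    calc (#Z : ℝ) * (s * a) ^ 2 = ∑ ω ∈ Z, (N * X ω - s * a) ^ 2 := by
          rw [Finset.sum_congr rfl (g := fun _ => (s * a) ^ 2), Finset.sum_const, nsmul_eq_mul]
          intro ω hω
          have : X ω = 0 := Finset.sum_eq_zero fun i hi => if_neg (hZ ω hω i hi)
          rw [this]
          ring
      _ ≤ _ := Finset.sum_le_sum_of_subset_of_nonneg (Finset.subset_univ _)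
          fun _ _ _ => sq_nonneg _
  rcases le_or_gt (s * a) 0 with h0 | h0
  · exact (mul_nonpos_of_nonneg_of_nonpos (by positivity) h0).trans (sq_nonneg N)
  · refine le_of_mul_le_mul_right ?_ h0
    nlinarith

variable {n b : ℕ}

theorem card_filter_exists_eq (hn : 1 ≤ n) (i : Fin n) :
    (#{g : Fin b → Fin n | ∃ r, g r = i} : ℝ) = (n : ℝ) ^ b - ((n : ℝ) - 1) ^ b := by
  have h := Finset.card_filter_add_card_filter_not (s := (univ : Finset (Fin b → Fin n)))
    (fun g => ∃ r, g r = i)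
  have h2 : (univ.filter fun g : Fin b → Fin n => ¬ ∃ r, g r = i)
      = Fintype.piFinset fun _ => univ.erase i := by
    ext g; simp [Fintype.mem_piFinset]
  rw [h2, Fintype.card_piFinset] at h
  simp only [Finset.card_erase_of_mem (Finset.mem_univ _), Finset.card_univ, Fintype.card_fin,
    Finset.prod_const, Fintype.card_fun] at h
  have h' := congrArg (Nat.cast : ℕ → ℝ) h
  push_cast [Nat.cast_sub hn] at h'
  linarith

theorem card_filter_exists_eq_inter (hn : 2 ≤ n) {i j : Fin n} (hij : i ≠ j) :
    (#(({g : Fin b → Fin n | ∃ r, g r = i} : Finset _) ∩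
      ({g : Fin b → Fin n | ∃ r, g r = j} : Finset _)) : ℝ)
      = (n : ℝ) ^ b - 2 * ((n : ℝ) - 1) ^ b + ((n : ℝ) - 2) ^ b := by
  have hu := Finset.card_union_add_card_inter ({g : Fin b → Fin n | ∃ r, g r = i} : Finset _)
    ({g : Fin b → Fin n | ∃ r, g r = j} : Finset _)
  have h := Finset.card_filter_add_card_filter_not (s := (univ : Finset (Fin b → Fin n)))
    (fun g => (∃ r, g r = i) ∨ ∃ r, g r = j)
  have h2 : (univ.filter fun g : Fin b → Fin n => ¬ ((∃ r, g r = i) ∨ ∃ r, g r = j))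
      = Fintype.piFinset fun _ => (univ.erase i).erase j := by
    ext g
    simp only [Finset.mem_filter, Finset.mem_univ, true_and, Fintype.mem_piFinset,
      Finset.mem_erase, ne_eq, and_true, not_or, not_exists]
    exact ⟨fun h r => ⟨h.2 r, h.1 r⟩, fun h => ⟨fun r => (h r).2, fun r => (h r).1⟩⟩
  rw [h2, Fintype.card_piFinset, Finset.filter_or] at h
  have hc : #((univ.erase i).erase j) = n - 2 := by
    rw [Finset.card_erase_of_mem (by simp [hij.symm]), Finset.card_erase_of_mem (by simp)]
    simp; omega
  simp only [hc, Finset.card_univ, Fintype.card_fin, Finset.prod_const, Fintype.card_fun] at h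
  have h' := congrArg (Nat.cast : ℕ → ℝ) h
  have hu' := congrArg (Nat.cast : ℕ → ℝ) hu
  push_cast [Nat.cast_sub hn] at h' hu'
  rw [card_filter_exists_eq (by omega), card_filter_exists_eq (by omega)] at hu'
  linarith

theorem one_sub_inv_pow_le (hn : 1 ≤ n) (hb : b ≤ n) :
    (1 - 1 / (n : ℝ)) ^ b ≤ 1 - b / (2 * n) := by
  have hn' : (1 : ℝ) ≤ n := by exact_mod_cast hn
  have hn0 : (0 : ℝ) < n := by linarith
  have hinv : 1 / (n : ℝ) ≤ 1 := by rw [div_le_one hn0]; exact hn'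
  have hinv0 : 0 < 1 / (n : ℝ) := by positivity
  set u := (1 - 1 / (n : ℝ)) ^ b with hu
  have hu0 : 0 ≤ u := pow_nonneg (by linarith) _
  set β : ℝ := b / n with hβ
  have hβ0 : 0 ≤ β := by positivity
  have hβ1 : β ≤ 1 := by rw [hβ, div_le_one hn0]; exact_mod_cast hb
  have hbern : 1 + β ≤ (1 + 1 / (n : ℝ)) ^ b := by
    have := one_add_mul_le_pow (a := 1 / (n : ℝ)) (by linarith) b
    calc 1 + β = 1 + b * (1 / (n : ℝ)) := by rw [hβ]; ring
      _ ≤ _ := this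
  have hprod : u * (1 + 1 / (n : ℝ)) ^ b ≤ 1 := by
    rw [hu, ← mul_pow]
    exact pow_le_one₀ (mul_nonneg (by linarith) (by linarith)) (by nlinarith)
  have h1 : u * (1 + β) ≤ 1 := (mul_le_mul_of_nonneg_left hbern hu0).trans hprod
  have h2 : (b : ℝ) / (2 * n) = β / 2 := by rw [hβ]; field_simp
  rw [h2]
  nlinarith

/-- Throwing `k` blocks of `b` balls into `n` bins, it is unlikely that every bin of a large
set `S` is missed by some block. -/
theorem card_forall_missed_mul_le (hn : 2 ≤ n) (hb : b ≤ n) (k : ℕ) (S : Finset (Fin n)) :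
    (#{h : Fin k → Fin b → Fin n | ∀ i ∈ S, ¬ ∀ j, ∃ r, h j r = i} : ℝ)
        * (#S * ((b : ℝ) / (2 * n)) ^ k) ≤ (n : ℝ) ^ (k * b) := by
  have hn' : (2 : ℝ) ≤ n := by exact_mod_cast hn
  have hn0 : (0 : ℝ) < n := by linarith
  let G : Fin n → Finset (Fin b → Fin n) := fun i => {g | ∃ r, g r = i}
  let A : Fin n → Finset (Fin k → Fin b → Fin n) := fun i => Fintype.piFinset fun _ => G i
  set q : ℝ := (n : ℝ) ^ b - ((n : ℝ) - 1) ^ b with hq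
  have hcard : (Fintype.card (Fin k → Fin b → Fin n) : ℝ) = ((n : ℝ) ^ b) ^ k := by simp
  have hA : ∀ i ∈ S, (#(A i) : ℝ) = q ^ k := by
    intro i _
    simp only [A, Fintype.card_piFinset, Finset.prod_const, Finset.card_univ, Fintype.card_fin,
      Nat.cast_pow]
    rw [card_filter_exists_eq (by omega)]
  have hpair : ∀ i ∈ S, ∀ j ∈ S, i ≠ j →
      (#(A i ∩ A j) : ℝ) * Fintype.card (Fin k → Fin b → Fin n) ≤ (q ^ k) ^ 2 := by
    intro i _ j _ hij
    have hAA : A i ∩ A j = Fintype.piFinset fun _ => G i ∩ G j := by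
      ext h
      simp [A, Fintype.mem_piFinset, forall_and]
    rw [hAA, hcard, ← pow_mul q, mul_comm k 2, pow_mul q]
    simp only [Fintype.card_piFinset, Finset.prod_const, Finset.card_univ, Fintype.card_fin,
      Nat.cast_pow]
    rw [← mul_pow]
    refine pow_le_pow_left₀ (by positivity) ?_ k
    rw [card_filter_exists_eq_inter hn hij, hq]
    have : ((n : ℝ) - 2) ^ b * (n : ℝ) ^ b ≤ (((n : ℝ) - 1) ^ b) ^ 2 := by
      rw [← mul_pow, ← pow_mul, mul_comm b 2, pow_mul]
      exact pow_le_pow_left₀ (mul_nonneg (by linarith) hn0.le) (by nlinarith) b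
    nlinarith
  have hmain := Finset.card_mul_le_of_forall_notMem S A hA hpair
    (Z := {h : Fin k → Fin b → Fin n | ∀ i ∈ S, ¬ ∀ j, ∃ r, h j r = i})
    (fun h hh i hi hA' => (Finset.mem_filter.1 hh).2 i hi fun j => by
      simpa [G] using Fintype.mem_piFinset.1 hA' j)
  rw [hcard] at hmain
  have hqlow : (n : ℝ) ^ b * (b / (2 * n)) ≤ q := by
    have h1 := one_sub_inv_pow_le (n := n) (b := b) (by omega) hb
    have h2 : ((n : ℝ) - 1) ^ b = (n : ℝ) ^ b * (1 - 1 / (n : ℝ)) ^ b := by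
      rw [← mul_pow]; congr 1; field_simp
    rw [hq, h2]
    nlinarith [pow_pos hn0 b]
  have hqk : ((n : ℝ) ^ b) ^ k * ((b : ℝ) / (2 * n)) ^ k ≤ q ^ k := by
    rw [← mul_pow]
    exact pow_le_pow_left₀ (by positivity) hqlow k
  have hNpos : 0 < ((n : ℝ) ^ b) ^ k := by positivity
  rw [mul_comm k b, pow_mul]
  refine le_of_mul_le_mul_right ?_ hNpos
  rw [← sq]
  refine le_trans ?_ hmain
  rw [mul_assoc]
  refine mul_le_mul_of_nonneg_left ?_ (by positivity)
  rw [mul_assoc]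
  refine mul_le_mul_of_nonneg_left ?_ (by positivity)
  rwa [mul_comm]

end Occupancy

section Asymptotics

theorem eventually_pow_ceil_log_div_log_log_le {ε : ℝ} (hε : 0 < ε) :
    ∀ᶠ n : ℕ in Filter.atTop,
      1 ≤ ⌈1 / 2 * (Real.log n / Real.log (Real.log n))⌉₊ ∧
      (32 * (⌈1 / 2 * (Real.log n / Real.log (Real.log n))⌉₊ : ℝ))
        ^ (⌈1 / 2 * (Real.log n / Real.log (Real.log n))⌉₊ + 1) ≤ ε * n := by
  have hL : Filter.Tendsto (fun n : ℕ => Real.log n) Filter.atTop Filter.atTop :=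
    Real.tendsto_log_atTop.comp tendsto_natCast_atTop_atTop
  have hev : ∀ᶠ L : ℝ in Filter.atTop,
      32 ≤ Real.log L ∧ 64 ≤ L ∧ Real.log L ≤ L / 8 ∧ -Real.log ε ≤ L / 4 := by
    have h3 := Real.isLittleO_log_id_atTop.bound (show (0 : ℝ) < 1 / 8 by norm_num)
    filter_upwards [Real.tendsto_log_atTop.eventually_ge_atTop 32,
      Filter.eventually_ge_atTop 64, h3, Filter.eventually_ge_atTop (4 * -Real.log ε)]
      with L h1 h2 h3 h4
    refine ⟨h1, h2, ?_, by linarith⟩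
    rw [Real.norm_eq_abs, id, Real.norm_eq_abs, abs_of_nonneg (by linarith),
      abs_of_nonneg (by linarith)] at h3
    linarith
  filter_upwards [hL.eventually hev, Filter.eventually_gt_atTop 0] with n ⟨h1, h2, h3, h4⟩ hn
  set L := Real.log n with hLdef
  set l := Real.log L with hl
  have hl0 : 0 < l := by linarith
  have hL0 : 0 < L := by linarith
  have hpos : 0 < 1 / 2 * (L / l) := by positivity
  set k := ⌈1 / 2 * (L / l)⌉₊ with hk
  have hk1 : 1 ≤ k := Nat.one_le_iff_ne_zero.2 (Nat.ceil_pos.2 hpos).ne'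
  have hkle : (k : ℝ) ≤ 1 / 2 * (L / l) + 1 := (Nat.ceil_lt_add_one hpos.le).le
  refine ⟨hk1, ?_⟩
  have hLl : L / l ≤ L / 32 := div_le_div_of_nonneg_left hL0.le (by norm_num) h1
  have hbase : 32 * (k : ℝ) ≤ L := by linarith
  have hnexp : (n : ℝ) = Real.exp L := (Real.exp_log (by exact_mod_cast hn)).symm
  calc (32 * (k : ℝ)) ^ (k + 1) ≤ L ^ (k + 1) := pow_le_pow_left₀ (by positivity) hbase _
    _ = Real.exp ((k + 1 : ℕ) * l) := by rw [Real.exp_nat_mul, hl, Real.exp_log hL0]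
    _ ≤ Real.exp (Real.log ε + L) := by
        apply Real.exp_le_exp.2
        have : L / l * l = L := by field_simp
        push_cast
        nlinarith
    _ = ε * n := by rw [Real.exp_add, Real.exp_log hε, hnexp]

end Asymptotics

namespace AllocProc

attribute [local instance] AllocProc.m0 AllocProc.prob

variable {n : ℕ} (P : AllocProc n)

theorem W_zero (ω : P.Ω) : P.W 0 ω = 0 := by simp [W, P.x_zero]

variable {P}

theorem UniformSampling.measureReal_inter (hU : P.UniformSampling) {t : ℕ} {A : Set P.Ω}
    (hA : MeasurableSet[P.F t] A) (i : Fin n) :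
    P.μ.real (A ∩ {ω | P.sel t ω = i}) = P.μ.real A / n := by
  have hm := P.F.le t
  have hsel : MeasurableSet[P.m0] {ω | P.sel t ω = i} :=
    P.F.le (t + 1) _ (P.meas_sel t (MeasurableSet.singleton i))
  have hint : Integrable (({ω' | P.sel t ω' = i} : Set P.Ω).indicator (fun _ => (1 : ℝ))) P.μ :=
    (integrable_const 1).indicator hsel
  have h := setIntegral_condExp hm hint hA
  rw [setIntegral_congr_ae (hm _ hA) ((hU t i).mono fun ω hω _ => hω),
    setIntegral_const, setIntegral_indicator hsel, setIntegral_const] at h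
  simp only [smul_eq_mul, mul_one] at h
  rw [← h]
  ring

theorem UniformSampling.measureReal_inter_forall (hU : P.UniformSampling) {s : ℕ} {A : Set P.Ω}
    (hA : MeasurableSet[P.F s] A) (m : ℕ) (f : Fin m → Fin n) :
    P.μ.real (A ∩ {ω | ∀ r : Fin m, P.sel (s + r) ω = f r}) = P.μ.real A / (n : ℝ) ^ m := by
  induction m with
  | zero => simp
  | succ m ih =>
    have hmeas : MeasurableSet[P.F (s + m)]
        (A ∩ {ω | ∀ r : Fin m, P.sel (s + r) ω = f r.castSucc}) := by
      refine MeasurableSet.inter (P.F.mono (by omega) _ hA) ?_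
      rw [Set.ofPred_forall]
      refine MeasurableSet.iInter fun r => ?_
      exact P.F.mono (by omega) _ (P.meas_sel (s + r) (MeasurableSet.singleton _))
    have hset : A ∩ {ω | ∀ r : Fin (m + 1), P.sel (s + r) ω = f r}
        = (A ∩ {ω | ∀ r : Fin m, P.sel (s + r) ω = f r.castSucc})
          ∩ {ω | P.sel (s + m) ω = f (Fin.last m)} := by
      ext ω
      simp [Fin.forall_fin_succ', and_assoc]
    rw [hset, hU.measureReal_inter hmeas, ih, pow_succ, div_div]

/-- The bins sampled in the rounds `s, …, s + k * b - 1`, arranged in `k` blocks of `b` rounds. -/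
def blocks (P : AllocProc n) (s k b : ℕ) (ω : P.Ω) (j : Fin k) (r : Fin b) : Fin n :=
  P.sel (s + (finProdFinEquiv (j, r) : Fin (k * b))) ω

theorem UniformSampling.measureReal_inter_blocks_mem (hU : P.UniformSampling) {s k b : ℕ}
    {A : Set P.Ω} (hA : MeasurableSet[P.F s] A) (B : Finset (Fin k → Fin b → Fin n)) :
    P.μ.real (A ∩ {ω | P.blocks s k b ω ∈ B}) ≤ P.μ.real A * (#B / (n : ℝ) ^ (k * b)) := by
  have hset : A ∩ {ω | P.blocks s k b ω ∈ B} ⊆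
      ⋃ h ∈ B, A ∩ {ω | ∀ x : Fin (k * b), P.sel (s + x) ω
        = h (finProdFinEquiv.symm x).1 (finProdFinEquiv.symm x).2} := by
    intro ω hω
    refine Set.mem_biUnion hω.2 ⟨hω.1, fun x => ?_⟩
    simp only [blocks, Prod.mk.eta, Equiv.apply_symm_apply]
  refine (measureReal_mono hset (measure_ne_top _ _)).trans
    ((measureReal_biUnion_finset_le _ _).trans_eq ?_)
  rw [Finset.sum_congr rfl fun h _ => hU.measureReal_inter_forall hA (k * b) _, Finset.sum_const,
    nsmul_eq_mul]
  ring

theorem CondW.le_succ (hW : P.CondW) (t : ℕ) (ω : P.Ω) (j : Fin n) :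
    P.x t ω j ≤ P.x (t + 1) ω j := by
  rcases le_or_gt 0 (P.y t ω (P.sel t ω)) with h | h
  · rw [(hW t ω).1 h j]; omega
  · exact ((hW t ω).2 h).1 j

theorem CondW.mono (hW : P.CondW) (ω : P.Ω) (j : Fin n) : Monotone fun t => P.x t ω j :=
  monotone_nat_of_le_succ fun t => hW.le_succ t ω j

theorem CondW.W_succ_of_nonneg (hW : P.CondW) {t : ℕ} {ω : P.Ω}
    (h : 0 ≤ P.y t ω (P.sel t ω)) : P.W (t + 1) ω = P.W t ω + 1 := by
  simp [W, (hW t ω).1 h, Finset.sum_add_distrib]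

theorem CondW.le_W (hW : P.CondW) (t : ℕ) (ω : P.Ω) : t ≤ P.W t ω := by
  induction t with
  | zero => simp
  | succ t ih =>
    rcases le_or_gt 0 (P.y t ω (P.sel t ω)) with h | h
    · rw [hW.W_succ_of_nonneg h]; omega
    · rw [((hW t ω).2 h).2.2.1]; omega

theorem W_div_le_one (hn : 0 < n) {t : ℕ} {ω : P.Ω} (h : P.W t ω ≤ n) :
    (P.W t ω : ℝ) / n ≤ 1 := by
  rw [div_le_one (by exact_mod_cast hn)]
  exact_mod_cast h

theorem CondW.W_le (hW : P.CondW) (hn : 0 < n) (ω : P.Ω) (t : ℕ) (ht : t ≤ n / 2) :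
    P.W t ω ≤ 2 * t := by
  induction t with
  | zero => simp [W_zero]
  | succ t ih =>
    have ih := ih (by omega)
    rcases le_or_gt 0 (P.y t ω (P.sel t ω)) with h | h
    · rw [hW.W_succ_of_nonneg h]; omega
    · have hc : ⌈-(P.y t ω (P.sel t ω))⌉₊ ≤ 1 := by
        rw [Nat.ceil_le]
        have h1 := W_div_le_one hn (ω := ω) (t := t) (by omega)
        have h2 : (0 : ℝ) ≤ P.x t ω (P.sel t ω) := by positivity
        simp only [y, Nat.cast_one]
        linarith
      rw [((hW t ω).2 h).2.2.1]; omega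

theorem CondW.succ_le_of_sel (hW : P.CondW) (hn : 0 < n) {t : ℕ} (ht : t ≤ n / 2) {ω : P.Ω}
    {i : Fin n} (hi : P.sel t ω = i) (hx : 1 ≤ P.x t ω i) :
    P.x t ω i + 1 ≤ P.x (t + 1) ω i := by
  subst hi
  have hy : 0 ≤ P.y t ω (P.sel t ω) := by
    have h1 := W_div_le_one hn (ω := ω) (t := t) (by have := hW.W_le hn ω t ht; omega)
    have h2 : (1 : ℝ) ≤ P.x t ω (P.sel t ω) := by exact_mod_cast hx
    simp only [y]
    linarith
  rw [(hW t ω).1 hy, if_pos rfl]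

theorem CondW.le_of_blocks (hW : P.CondW) (hn : 0 < n) {s k b : ℕ} (hs : s + k * b ≤ n / 2)
    {ω : P.Ω} {i : Fin n} (hx : 1 ≤ P.x s ω i) (hi : ∀ j, ∃ r, P.blocks s k b ω j r = i)
    (j : ℕ) (hj : j ≤ k) : j + 1 ≤ P.x (s + b * j) ω i := by
  induction j with
  | zero => simpa using hx
  | succ j ih =>
    have ih := ih (by omega)
    obtain ⟨r, hr⟩ := hi ⟨j, hj⟩
    simp only [blocks, finProdFinEquiv_apply_val] at hr
    have hjb : b * j + b ≤ k * b := by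
      calc b * j + b = (j + 1) * b := by ring
        _ ≤ k * b := Nat.mul_le_mul_right _ hj
    have hrb := r.isLt
    have h1 : P.x (s + b * j) ω i ≤ P.x (s + (r + b * j)) ω i := hW.mono ω i (by omega)
    have h2 := hW.succ_le_of_sel hn (by omega) hr (by omega)
    have h3 : P.x (s + (r + b * j) + 1) ω i ≤ P.x (s + b * (j + 1)) ω i :=
      hW.mono ω i (by rw [mul_add]; omega)
    omega

theorem CondW.le_Gap (hW : P.CondW) (hn : 0 < n) {k : ℕ} {t : ℕ} (ht : t ≤ n / 2) {ω : P.Ω}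
    {i : Fin n} (hx : k + 1 ≤ P.x t ω i) : (k : ℝ) ≤ P.Gap (n / 2) ω := by
  have h1 := W_div_le_one hn (ω := ω) (t := n / 2) (by have := hW.W_le hn ω (n / 2) le_rfl; omega)
  have h2 : (P.x (n / 2) ω i : ℝ) ≤ ⨆ i, (P.x (n / 2) ω i : ℝ) :=
    le_ciSup (Set.finite_range fun i => (P.x (n / 2) ω i : ℝ)).bddAbove i
  have h3 : ((k + 1 : ℕ) : ℝ) ≤ P.x (n / 2) ω i := by exact_mod_cast hx.trans (hW.mono ω i ht)
  push_cast at h3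
  simp only [Gap]
  linarith

/-- The set of nonempty bins after `t` rounds. -/
def nonempty (P : AllocProc n) (t : ℕ) (ω : P.Ω) : Finset (Fin n) := {i | 1 ≤ P.x t ω i}

theorem measurableSet_nonempty_eq (t : ℕ) (S : Finset (Fin n)) :
    MeasurableSet[P.F t] {ω | P.nonempty t ω = S} := by
  have : {ω | P.nonempty t ω = S} = ⋂ i, {ω | P.x t ω i ∈ {m : ℕ | 1 ≤ m ↔ i ∈ S}} := by
    ext ω
    simp [nonempty, Finset.ext_iff]
  rw [this]
  exact MeasurableSet.iInter fun i => P.meas_x t i (MeasurableSet.of_discrete)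

theorem CondW.le_card_nonempty (hW : P.CondW) {s k : ℕ} {ω : P.Ω} (h : ∀ i, P.x s ω i ≤ k) :
    s ≤ #(P.nonempty s ω) * k := by
  calc s ≤ P.W s ω := hW.le_W s ω
    _ = ∑ i ∈ P.nonempty s ω, P.x s ω i := by
        rw [W, nonempty, Finset.sum_filter]
        refine Finset.sum_congr rfl fun i _ => ?_
        split_ifs with hi <;> omega
    _ ≤ _ := by simpa using Finset.sum_le_card_nsmul _ _ k fun i _ => h i

theorem CondW.measureReal_Gap_lt_le (hW : P.CondW) (hU : P.UniformSampling) (hn : 2 ≤ n)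
    {s k b : ℕ} (hs : s + k * b ≤ n / 2) (hs0 : 0 < s) (hk : 0 < k) (hb : 0 < b) (hbn : b ≤ n) :
    P.μ.real {ω | P.Gap (n / 2) ω < k} ≤ (s / k * ((b : ℝ) / (2 * n)) ^ k)⁻¹ := by
  set δ : ℝ := (s / k * ((b : ℝ) / (2 * n)) ^ k)⁻¹ with hδ
  let B : Finset (Fin n) → Finset (Fin k → Fin b → Fin n) := fun S =>
    {h | ∀ i ∈ S, ¬ ∀ j, ∃ r, h j r = i}
  let E : Finset (Fin n) → Set P.Ω := fun S => {ω | P.nonempty s ω = S}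
  let T : Finset (Finset (Fin n)) := {S | s ≤ #S * k}
  have hnpos : (0 : ℝ) < n := by exact_mod_cast (by omega : 0 < n)
  have hspos : (0 : ℝ) < s := by exact_mod_cast hs0
  have hkpos : (0 : ℝ) < k := by exact_mod_cast hk
  have hbpos : (0 : ℝ) < b := by exact_mod_cast hb
  have hδ0 : 0 ≤ δ := by positivity
  have hB : ∀ S ∈ T, (#(B S) : ℝ) / (n : ℝ) ^ (k * b) ≤ δ := by
    intro S hS
    have hS' : (s : ℝ) ≤ #S * k := by exact_mod_cast (Finset.mem_filter.1 hS).2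
    have h := card_forall_missed_mul_le hn hbn k S
    rw [hδ, div_le_iff₀ (by positivity), inv_mul_eq_div, le_div_iff₀ (by positivity)]
    refine le_trans (mul_le_mul_of_nonneg_left ?_ (by positivity)) h
    refine mul_le_mul_of_nonneg_right ?_ (by positivity)
    rwa [div_le_iff₀ hkpos]
  have hsub : {ω | P.Gap (n / 2) ω < k} ⊆ ⋃ S ∈ T, E S ∩ {ω | P.blocks s k b ω ∈ B S} := by
    intro ω hω
    have hω' : ¬ (k : ℝ) ≤ P.Gap (n / 2) ω := not_le.2 hω
    refine Set.mem_biUnion (x := P.nonempty s ω) ?_ ⟨rfl, ?_⟩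
    · refine Finset.mem_coe.2 (Finset.mem_filter.2 ⟨Finset.mem_univ _, hW.le_card_nonempty ?_⟩)
      intro i
      by_contra! hi
      exact hω' (hW.le_Gap (by omega) (t := s) (by omega) hi)
    · refine Finset.mem_filter.2 ⟨Finset.mem_univ _, fun i hi hall => hω' ?_⟩
      have hx : 1 ≤ P.x s ω i := (Finset.mem_filter.1 hi).2
      exact hW.le_Gap (by omega) (t := s + b * k) (by rwa [mul_comm b k])
        (hW.le_of_blocks (by omega) hs hx hall k le_rfl)
  calc P.μ.real {ω | P.Gap (n / 2) ω < k}
      ≤ ∑ S ∈ T, P.μ.real (E S ∩ {ω | P.blocks s k b ω ∈ B S}) :=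
        (measureReal_mono hsub (measure_ne_top _ _)).trans (measureReal_biUnion_finset_le _ _)
    _ ≤ ∑ S ∈ T, P.μ.real (E S) * δ := Finset.sum_le_sum fun S hS =>
        (hU.measureReal_inter_blocks_mem (measurableSet_nonempty_eq s S) _).trans
          (mul_le_mul_of_nonneg_left (hB S hS) measureReal_nonneg)
    _ = P.μ.real (⋃ S ∈ T, E S) * δ := by
        rw [← Finset.sum_mul, measureReal_biUnion_finset]
        · intro S _ S' _ hSS'
          exact Set.disjoint_left.2 fun ω h h' => hSS' (h.symm.trans h')
        · exact fun S _ => P.F.le s _ (measurableSet_nonempty_eq s S)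
    _ ≤ 1 * δ := mul_le_mul_of_nonneg_right measureReal_le_one hδ0
    _ = δ := one_mul δ

theorem CondW.measureReal_Gap_lt_le_of_pow_le (hW : P.CondW) (hU : P.UniformSampling)
    {k : ℕ} {ε : ℝ} (hk : 1 ≤ k) (hε1 : ε ≤ 1)
    (h : (32 * (k : ℝ)) ^ (k + 1) ≤ ε * n) :
    P.μ.real {ω | P.Gap (n / 2) ω < k} ≤ ε := by
  have hkpos : (1 : ℝ) ≤ k := by exact_mod_cast hk
  have hkn : (32 * (k : ℝ)) ^ 2 ≤ n :=
    calc (32 * (k : ℝ)) ^ 2 ≤ (32 * (k : ℝ)) ^ (k + 1) :=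
          pow_le_pow_right₀ (by linarith) (by omega)
      _ ≤ ε * n := h
      _ ≤ 1 * n := mul_le_mul_of_nonneg_right hε1 (by positivity)
      _ = n := one_mul _
  have hkn' : 1024 * k ≤ n := by
    have : (1024 * k : ℝ) ≤ n := by nlinarith
    exact_mod_cast this
  have hnpos : (0 : ℝ) < n := by exact_mod_cast (by omega : 0 < n)
  set m := n / 2 - n / 4 with hm
  set b := m / k with hb
  have hb1 : 1 ≤ b := (Nat.one_le_div_iff (by omega)).2 (by omega)
  have hkb : k * b ≤ m := Nat.mul_div_le m k
  have hmb : m < k * (b + 1) := Nat.lt_mul_div_succ m (by omega)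
  have hkb1 : k * 1 ≤ k * b := Nat.mul_le_mul_left k hb1
  have hbkb : 1 * b ≤ k * b := Nat.mul_le_mul_right b hk
  rw [mul_add] at hmb
  have hbig := hW.measureReal_Gap_lt_le hU (by omega) (s := n / 4) (k := k) (b := b) (by omega)
    (by omega) (by omega) hb1 (by omega)
  refine hbig.trans ?_
  have hs : (n : ℝ) ≤ 8 * (n / 4 : ℕ) := by exact_mod_cast (by omega : n ≤ 8 * (n / 4))
  have hb' : (n : ℝ) ≤ 16 * (k * b) := by exact_mod_cast (by omega : n ≤ 16 * (k * b))
  have h1 : (n : ℝ) / (32 * k) ≤ ((n / 4 : ℕ) : ℝ) / k := by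
    rw [div_le_div_iff₀ (by positivity) (by positivity)]
    nlinarith
  have h2 : 1 / (32 * (k : ℝ)) ≤ (b : ℝ) / (2 * n) := by
    rw [div_le_div_iff₀ (by positivity) (by positivity)]
    nlinarith
  have hεpos : 0 < ε := by
    have : 0 < ε * n := lt_of_lt_of_le (by positivity) h
    exact pos_of_mul_pos_left this hnpos.le
  apply inv_le_of_inv_le₀ hεpos
  calc ε⁻¹ ≤ n / (32 * (k : ℝ)) ^ (k + 1) := by
        rw [le_div_iff₀ (by positivity), inv_mul_le_iff₀ hεpos]
        exact h
    _ = n / (32 * k) * (1 / (32 * (k : ℝ))) ^ k := by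
        rw [pow_succ, div_pow, one_pow]
        field_simp
    _ ≤ _ := mul_le_mul h1 (pow_le_pow_left₀ (by positivity) h2 k) (by positivity) (by positivity)

end AllocProc

/-- **Lemma 5.1.** For any allocation process with a uniform probability vector satisfying
condition `𝒲`, `Gap(n/2) ≥ (1/2) log n / log log n` with probability `1 - o(1)` as
`n → ∞`. -/
theorem uniform_lower_bound :
    ∀ ε : ℝ, 0 < ε → ∃ N : ℕ, ∀ n : ℕ, N ≤ n →
      ∀ P : AllocProc n, P.UniformSampling → P.CondW →
        P.μ {ω | 1 / 2 * (Real.log n / Real.log (Real.log n)) ≤ P.Gap (n / 2) ω}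
          ≥ 1 - ENNReal.ofReal ε := by
  intro ε hε
  have hε' : 0 < min ε 1 := lt_min hε one_pos
  obtain ⟨N, hN⟩ := Filter.eventually_atTop.1 (eventually_pow_ceil_log_div_log_log_le hε')
  refine ⟨N, fun n hn P hU hW => ?_⟩
  have := P.prob
  obtain ⟨hk, hpow⟩ := hN n hn
  set k := ⌈1 / 2 * (Real.log n / Real.log (Real.log n))⌉₊
  have hbad := hW.measureReal_Gap_lt_le_of_pow_le hU hk (min_le_right _ _) hpow
  set G := {ω | 1 / 2 * (Real.log n / Real.log (Real.log n)) ≤ P.Gap (n / 2) ω}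
  have hsub : Gᶜ ⊆ {ω | P.Gap (n / 2) ω < k} := by
    intro ω hω
    have h : P.Gap (n / 2) ω < 1 / 2 * (Real.log n / Real.log (Real.log n)) :=
      not_le.1 fun h => hω h
    exact h.trans_le (Nat.le_ceil _)
  have hcompl : P.μ Gᶜ ≤ ENNReal.ofReal ε := by
    refine (measure_mono hsub).trans ?_
    rw [← ofReal_measureReal]
    exact ENNReal.ofReal_le_ofReal (hbad.trans (min_le_left _ _))
  rw [ge_iff_le, tsub_le_iff_right]
  calc (1 : ℝ≥0∞) = P.μ (G ∪ Gᶜ) := by rw [Set.union_compl_self, measure_univ]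
    _ ≤ P.μ G + P.μ Gᶜ := measure_union_le _ _
    _ ≤ _ := add_le_add_right hcompl _
end
end
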